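/- arXiv:2308.03085 — 2 statements merged into one kernel-verified Lean document; each statement's English description precedes it below -/
import Mathlib

section
/- Let n ≥ 3 and let P ⊆ ℝ^n be a monotone polytope that admits a monotone blow-up at some vertex v of P. Then P is AGL(n,ℤ)-equivalent either to the monotone simplex Δ, or to the monotone blow-up of Δ at one of its codimension-two faces. -/
open Finset

/-- Real dot product of an integer vector with a real vector. -/
def dotZ {n : ℕ} (u : Fin n → ℤ) (x : Fin n → ℝ) : ℝ := ∑ i, (u i : ℝ) * x i

/-- Real dot product. -/
def dotR {n : ℕ} (u x : Fin n → ℝ) : ℝ := ∑ i, u i * x i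

/-- A point of `ℝ^n` is a lattice point if all its coordinates are integers. -/
def IsLatticePt {n : ℕ} (x : Fin n → ℝ) : Prop := ∀ i, ∃ m : ℤ, x i = (m : ℝ)

/-- A (full-dimensional) lattice polytope: the convex hull of a finite set of
lattice points whose affine span is all of `ℝ^n`. -/
def IsLatticePolytope {n : ℕ} (P : Set (Fin n → ℝ)) : Prop :=
  ∃ V : Finset (Fin n → ℝ), (∀ v ∈ V, IsLatticePt v) ∧
    P = convexHull ℝ (V : Set (Fin n → ℝ)) ∧ affineSpan ℝ P = ⊤

/-- `F` is an (exposed) face of `P`: the set of maximizers over `P` of some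
linear functional. -/
def IsFaceOf {n : ℕ} (P F : Set (Fin n → ℝ)) : Prop :=
  ∃ u : Fin n → ℝ, F = {x ∈ P | ∀ y ∈ P, dotR u y ≤ dotR u x}

/-- The dimension of a subset of `ℝ^n` (dimension of its affine hull). -/
noncomputable def dimSet {n : ℕ} (F : Set (Fin n → ℝ)) : ℕ :=
  Module.finrank ℝ (vectorSpan ℝ F)

/-- A facet of `P`: a nonempty face of dimension `n - 1`. -/
def IsFacetOf {n : ℕ} (P F : Set (Fin n → ℝ)) : Prop :=
  IsFaceOf P F ∧ F.Nonempty ∧ dimSet F + 1 = n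

/-- A vertex of `P`: a point such that `{v}` is a face. -/
def IsVertexOf {n : ℕ} (P : Set (Fin n → ℝ)) (v : Fin n → ℝ) : Prop :=
  IsFaceOf P {v}

/-- An edge of `P`: a face which is a nondegenerate segment. -/
def IsEdgeOf {n : ℕ} (P E : Set (Fin n → ℝ)) : Prop :=
  IsFaceOf P E ∧ ∃ a b : Fin n → ℝ, a ≠ b ∧ E = segment ℝ a b

/-- An integer vector is primitive if the gcd of its coordinates is 1. -/
def IsPrimitiveZ {n : ℕ} (u : Fin n → ℤ) : Prop := Finset.univ.gcd u = 1

/-- `u` is the primitive outer normal of the facet `F` of `P`. -/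
def IsFacetNormal {n : ℕ} (P F : Set (Fin n → ℝ)) (u : Fin n → ℤ) : Prop :=
  IsPrimitiveZ u ∧ IsFacetOf P F ∧
    F = {x ∈ P | ∀ y ∈ P, dotZ u y ≤ dotZ u x}

/-- `u` is the central normal vector of the face `G` of `P`: the sum of the
primitive outer normals of all the facets of `P` containing `G`. -/
def IsCentralNormal {n : ℕ} (P G : Set (Fin n → ℝ)) (u : Fin n → ℤ) : Prop :=
  ∃ (m : ℕ) (Fs : Fin m → Set (Fin n → ℝ)) (us : Fin m → Fin n → ℤ),
    Function.Injective Fs ∧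
    (∀ i, G ⊆ Fs i ∧ IsFacetNormal P (Fs i) (us i)) ∧
    (∀ F, IsFacetOf P F → G ⊆ F → ∃ i, F = Fs i) ∧
    u = ∑ i, us i

/-- The lattice length of the segment from `a` to `b`. -/
def LatticeLength {n : ℕ} (a b : Fin n → ℝ) (ℓ : ℕ) : Prop :=
  ∃ d : Fin n → ℤ, IsPrimitiveZ d ∧ ∀ i, b i - a i = (ℓ : ℝ) * (d i : ℝ)

/-- `d` is the primitive integer direction vector of the edge `E` at its
endpoint `v`, pointing away from `v`. -/
def EdgeDirAt {n : ℕ} (v : Fin n → ℝ) (E : Set (Fin n → ℝ)) (d : Fin n → ℤ) : Prop :=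
  IsPrimitiveZ d ∧ ∃ w ∈ E, ∃ t : ℝ, 0 < t ∧ ∀ i, w i - v i = t * (d i : ℝ)

/-- A polytope is smooth (Delzant) if every vertex lies in exactly `n` facets
and the primitive direction vectors of the `n` edges incident to each vertex
form a basis of the lattice `ℤ^n`. -/
def IsSmoothPolytope {n : ℕ} (P : Set (Fin n → ℝ)) : Prop :=
  ∀ v : Fin n → ℝ, IsVertexOf P v →
    (∃ Fs : Fin n → Set (Fin n → ℝ), Function.Injective Fs ∧
      (∀ i, IsFacetOf P (Fs i) ∧ v ∈ Fs i) ∧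
      (∀ F, IsFacetOf P F → v ∈ F → ∃ i, F = Fs i)) ∧
    (∃ (E : Fin n → Set (Fin n → ℝ)) (d : Fin n → Fin n → ℤ),
      Function.Injective E ∧
      (∀ i, IsEdgeOf P (E i) ∧ v ∈ E i ∧ EdgeDirAt v (E i) (d i)) ∧
      (∀ E', IsEdgeOf P E' → v ∈ E' → ∃ i, E' = E i) ∧
      IsUnit (Matrix.det (Matrix.of d)))

/-- A polytope is reflexive if the origin is in its interior and every facet is
supported at value `1` by its primitive outer normal. -/
def IsReflexivePolytope {n : ℕ} (P : Set (Fin n → ℝ)) : Prop :=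
  (0 : Fin n → ℝ) ∈ interior P ∧
  ∀ F u, IsFacetNormal P F u → ∀ x ∈ F, dotZ u x = 1

/-- A monotone polytope (= smooth reflexive polytope). -/
def IsMonotonePolytope {n : ℕ} (P : Set (Fin n → ℝ)) : Prop :=
  IsLatticePolytope P ∧ IsSmoothPolytope P ∧ IsReflexivePolytope P

/-- `F` is a nonempty face of `P` of codimension `k`. -/
def HasCodim {n : ℕ} (P F : Set (Fin n → ℝ)) (k : ℕ) : Prop :=
  IsFaceOf P F ∧ F.Nonempty ∧ dimSet F + k = n

/-- The monotone blow-up `P ∩ {x : u·x ≤ 1}` of a monotone polytope at a face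
with central normal `u`. -/
def blowupSet {n : ℕ} (P : Set (Fin n → ℝ)) (u : Fin n → ℤ) : Set (Fin n → ℝ) :=
  {x ∈ P | dotZ u x ≤ 1}

/-- The region removed from `P` by the monotone blow-up with central normal `u`. -/
def removedRegion {n : ℕ} (P : Set (Fin n → ℝ)) (u : Fin n → ℤ) : Set (Fin n → ℝ) :=
  {x ∈ P | 1 < dotZ u x}

/-- `P` admits a monotone blow-up at its face `F` with central normal `u`:
every vertex of `P` not in `F` satisfies `u·v ≤ 0`, and the blow-up is again a
monotone polytope. -/
def AdmitsMonotoneBlowup {n : ℕ} (P F : Set (Fin n → ℝ)) (u : Fin n → ℤ) : Prop :=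
  IsCentralNormal P F u ∧
  (∀ v, IsVertexOf P v → v ∉ F → dotZ u v ≤ 0) ∧
  IsMonotonePolytope (blowupSet P u)

/-- The monotone simplex `{x : x i ≥ -1 ∀ i, ∑ x i ≤ 1}` in `ℝ^n`. -/
def monotoneSimplex (n : ℕ) : Set (Fin n → ℝ) :=
  {x | (∀ i, -1 ≤ x i) ∧ ∑ i, x i ≤ 1}

/-- `AGL(n,ℤ)`-equivalence of subsets of `ℝ^n`: some map `x ↦ Ax + t` with
`A ∈ GL(n,ℤ)` and `t ∈ ℤ^n` maps `P` onto `Q`. -/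
def AGLEquiv {n : ℕ} (P Q : Set (Fin n → ℝ)) : Prop :=
  ∃ (A : Matrix (Fin n) (Fin n) ℤ) (t : Fin n → ℤ), IsUnit A.det ∧
    (fun x : Fin n → ℝ => fun i => (∑ j, (A i j : ℝ) * x j) + (t i : ℝ)) '' P = Q

open scoped NNReal

section Faces

variable {n : ℕ}

theorem exists_dotR_eq (f : (Fin n → ℝ) →L[ℝ] ℝ) : ∃ u : Fin n → ℝ, ∀ x, dotR u x = f x := by
  refine ⟨fun i => f (Pi.single i 1), fun x => ?_⟩
  conv_rhs => rw [pi_eq_sum_univ' x, map_sum]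
  refine Finset.sum_congr rfl fun i _ => ?_
  rw [map_smul, smul_eq_mul, mul_comm]

theorem exists_clm_eq_dotR (u : Fin n → ℝ) : ∃ f : (Fin n → ℝ) →L[ℝ] ℝ, ∀ x, f x = dotR u x :=
  ⟨∑ i, u i • ContinuousLinearMap.proj (R := ℝ) (φ := fun _ : Fin n => ℝ) i, fun x => by
    simp [dotR]⟩

theorem IsFaceOf.isExposed {P F : Set (Fin n → ℝ)} (h : IsFaceOf P F) : IsExposed ℝ P F := by
  obtain ⟨u, rfl⟩ := h
  obtain ⟨f, hf⟩ := exists_clm_eq_dotR u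
  exact fun _ => ⟨f, by simp only [hf]⟩

theorem isFaceOf_of_clm (P : Set (Fin n → ℝ)) (f : (Fin n → ℝ) →L[ℝ] ℝ) :
    IsFaceOf P {x ∈ P | ∀ y ∈ P, f y ≤ f x} := by
  obtain ⟨u, hu⟩ := exists_dotR_eq f
  exact ⟨u, by simp only [hu]⟩

theorem IsVertexOf.mem_extremePoints {P : Set (Fin n → ℝ)} {v : Fin n → ℝ} (h : IsVertexOf P v) :
    v ∈ P.extremePoints ℝ :=
  isExtreme_singleton.1 (IsFaceOf.isExposed h).isExtreme

theorem IsVertexOf.mem {P : Set (Fin n → ℝ)} {v : Fin n → ℝ} (h : IsVertexOf P v) : v ∈ P :=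
  h.mem_extremePoints.1

/-- A vertex is the unique maximizer of some functional. -/
theorem IsVertexOf.exists_lt {P : Set (Fin n → ℝ)} {v : Fin n → ℝ} (h : IsVertexOf P v) :
    ∃ f : (Fin n → ℝ) →L[ℝ] ℝ, ∀ x ∈ P, x ≠ v → f x < f v := by
  have hv := h.mem
  obtain ⟨f, hf⟩ := (IsFaceOf.isExposed h) (Set.singleton_nonempty v)
  have hvm : v ∈ {x ∈ P | ∀ y ∈ P, f y ≤ f x} := hf ▸ Set.mem_singleton v
  refine ⟨f, fun x hx hxv => lt_of_le_of_ne (hvm.2 x hx) fun heq => hxv ?_⟩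
  have : x ∈ ({v} : Set (Fin n → ℝ)) := by
    rw [hf]
    exact ⟨hx, fun y hy => heq ▸ hvm.2 y hy⟩
  exact this

theorem isVertexOf_of_mem_extremePoints {V : Finset (Fin n → ℝ)} {v : Fin n → ℝ}
    (h : v ∈ (convexHull ℝ (V : Set (Fin n → ℝ))).extremePoints ℝ) :
    IsVertexOf (convexHull ℝ (V : Set (Fin n → ℝ))) v := by
  have hvV : v ∈ V := extremePoints_convexHull_subset h
  have hnot : v ∉ convexHull ℝ (V.erase v : Set (Fin n → ℝ)) := fun hmem => by
    refine ((convex_convexHull ℝ _).mem_extremePoints_iff_mem_sdiff_convexHull_sdiff.1 h).2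
      (convexHull_mono ?_ hmem)
    intro x hx
    have hx' := Finset.mem_erase.1 hx
    exact ⟨subset_convexHull ℝ _ hx'.2, hx'.1⟩
  obtain ⟨f, c, hfc, hcv⟩ := geometric_hahn_banach_closed_point (convex_convexHull ℝ _)
    ((V.erase v).finite_toSet.isCompact_convexHull (𝕜 := ℝ)).isClosed hnot
  have hlt : ∀ x ∈ convexHull ℝ (V : Set (Fin n → ℝ)), x = v ∨ f x < f v := by
    intro x hx
    rw [← Finset.insert_erase hvV, Finset.coe_insert] at hx
    rcases (V.erase v).eq_empty_or_nonempty with he | hne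
    · left
      simpa [he] using hx
    · rw [convexHull_insert (Finset.coe_nonempty.2 hne), convexJoin_singleton_left] at hx
      obtain ⟨z, hz, a, b, ha, hb, hab, rfl⟩ := Set.mem_iUnion₂.1 hx
      have hfz := (hfc z hz).trans hcv
      rcases hb.eq_or_lt with rfl | hb
      · left
        simp_all
      · right
        simp only [map_add, map_smul, smul_eq_mul]
        obtain rfl : a = 1 - b := by linarith
        nlinarith
  have hface := isFaceOf_of_clm (convexHull ℝ (V : Set (Fin n → ℝ))) f
  rw [IsVertexOf]
  convert hface using 1
  ext x
  constructor
  · rintro rfl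
    refine ⟨h.1, fun y hy => ?_⟩
    rcases hlt y hy with rfl | hy
    exacts [le_rfl, hy.le]
  · rintro ⟨hx, hmax⟩
    rcases hlt x hx with rfl | hx
    exacts [rfl, absurd (hmax v h.1) (not_le.2 hx)]

/-- Every finite set in an open half-space lies in the cone over a subset of it, all of whose
elements span exposed rays of that cone. -/
theorem exists_exposed_generators {E : Type*} [NormedAddCommGroup E] [NormedSpace ℝ E]
    (S : Finset E) (φ : E →L[ℝ] ℝ) (hφ : ∀ s ∈ S, φ s < 0) :
    ∃ T ⊆ S, (S : Set E) ⊆ Submodule.span ℝ≥0 (T : Set E) ∧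
      ∀ g ∈ T, ∃ f : E →L[ℝ] ℝ, f g = 0 ∧ ∀ s ∈ T, s ≠ g → f s < 0 := by
  classical
  obtain ⟨T, hT, hmin⟩ := Finset.exists_min_image (S.powerset.filter
    fun T : Finset E => (S : Set E) ⊆ Submodule.span ℝ≥0 (T : Set E)) Finset.card
    ⟨S, by simp⟩
  simp only [Finset.mem_filter, Finset.mem_powerset] at hT hmin
  refine ⟨T, hT.1, hT.2, fun g hg => ?_⟩
  have hgn : g ∉ Submodule.span ℝ≥0 (T.erase g : Set E) := fun hmem => by
    have hTspan : (T : Set E) ⊆ Submodule.span ℝ≥0 (T.erase g : Set E) := by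
      intro t ht
      by_cases h : t = g
      · exact h ▸ hmem
      · exact Submodule.subset_span (by simpa [h] using ht)
    have := hmin (T.erase g) ⟨(Finset.erase_subset _ _).trans hT.1,
      hT.2.trans (Submodule.span_le.2 hTspan)⟩
    exact absurd (Finset.card_erase_lt_of_mem hg) (not_lt.2 this)
  have hdisj : Disjoint (convexHull ℝ (T.erase g : Set E))
      (Submodule.span ℝ ({g} : Set E) : Set E) := by
    rw [Set.disjoint_left]
    intro y hy hyg
    obtain ⟨m, rfl⟩ := Submodule.mem_span_singleton.1 hyg
    have hneg : φ (m • g) < 0 := by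
      have : convexHull ℝ (T.erase g : Set E) ⊆ {x | φ x < 0} :=
        convexHull_min (fun x hx => hφ x (hT.1 (Finset.mem_of_mem_erase hx)))
          (convex_halfSpace_lt φ.toLinearMap.isLinear 0)
      exact this hy
    have hcone : m • g ∈ Submodule.span ℝ≥0 (T.erase g : Set E) := by
      refine convexHull_min (t := (Submodule.span ℝ≥0 (T.erase g : Set E) : Set E))
        Submodule.subset_span ?_ hy
      intro x hx y hy a b ha hb _
      exact add_mem (Submodule.smul_mem _ (⟨a, ha⟩ : ℝ≥0) hx)
        (Submodule.smul_mem _ (⟨b, hb⟩ : ℝ≥0) hy)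
    have hm : 0 < m := by
      have := hφ g (hT.1 hg)
      rw [map_smul, smul_eq_mul] at hneg
      by_contra! h
      nlinarith
    refine hgn ?_
    have hmem : m⁻¹ • m • g ∈ Submodule.span ℝ≥0 (T.erase g : Set E) :=
      Submodule.smul_mem _ (⟨m⁻¹, (inv_pos.2 hm).le⟩ : ℝ≥0) hcone
    rwa [inv_smul_smul₀ hm.ne'] at hmem
  obtain ⟨f, a, b, hfa, hab, hfb⟩ := geometric_hahn_banach_compact_closed
    (convex_convexHull ℝ _) ((T.erase g).finite_toSet.isCompact_convexHull (𝕜 := ℝ))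
    (Submodule.span ℝ ({g} : Set E)).convex
    (Submodule.closed_of_finiteDimensional _) hdisj
  have hb0 : b < 0 := by simpa using hfb 0 (zero_mem _)
  refine ⟨f, ?_, fun s hs hsg => ?_⟩
  · by_contra hne
    have := hfb ((b / f g) • g) (Submodule.smul_mem _ _ (Submodule.mem_span_singleton_self g))
    rw [map_smul, smul_eq_mul, div_mul_cancel₀ _ hne] at this
    exact lt_irrefl _ this
  · exact ((hfa s (subset_convexHull ℝ _ (by simpa [hsg] using hs))).trans hab).trans hb0

end Faces

section Edges

variable {n : ℕ}

theorem neg_or_eq_zero_of_mem_span {E : Type*} [NormedAddCommGroup E] [NormedSpace ℝ E]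
    {T : Set E} {f : E →L[ℝ] ℝ} (hf : ∀ s ∈ T, f s < 0) {x : E}
    (hx : x ∈ Submodule.span ℝ≥0 T) : f x < 0 ∨ x = 0 := by
  induction hx using Submodule.span_induction with
  | mem x hx => exact .inl (hf x hx)
  | zero => exact .inr rfl
  | add x y _ _ hx hy =>
    rcases hx with hx | rfl
    · rcases hy with hy | rfl
      · exact .inl (by rw [map_add]; linarith)
      · exact .inl (by simpa using hx)
    · simpa using hy
  | smul a x _ hx =>
    rcases hx with hx | rfl
    · rcases eq_or_ne a 0 with rfl | ha
      · exact .inr (zero_smul _ _)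
      · refine .inl ?_
        have ha' : (0 : ℝ) < a := by positivity
        have : f (a • x) = (a : ℝ) * f x := by
          rw [NNReal.smul_def, map_smul, smul_eq_mul]
        rw [this]
        exact mul_neg_of_pos_of_neg ha' hx
    · exact .inr (smul_zero _)

/-- A linear functional that is minimal at `v` along every edge of a polytope through the vertex
`v` is minimal at `v` on the whole polytope. -/
theorem le_of_forall_edge_le {V : Finset (Fin n → ℝ)} {v : Fin n → ℝ}
    (hv : IsVertexOf (convexHull ℝ (V : Set (Fin n → ℝ))) v) (l : (Fin n → ℝ) →L[ℝ] ℝ)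
    (hl : ∀ E, IsEdgeOf (convexHull ℝ (V : Set (Fin n → ℝ))) E → v ∈ E → ∀ x ∈ E, l v ≤ l x) :
    ∀ x ∈ convexHull ℝ (V : Set (Fin n → ℝ)), l v ≤ l x := by
  classical
  set P := convexHull ℝ (V : Set (Fin n → ℝ)) with hPdef
  have hPconv : Convex ℝ P := convex_convexHull ℝ _
  obtain ⟨φ, hφ⟩ := hv.exists_lt
  set S := (V.erase v).image (fun w => w - v) with hS
  have hSφ : ∀ s ∈ S, φ s < 0 := by
    intro s hs
    obtain ⟨w, hw, rfl⟩ := Finset.mem_image.1 hs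
    obtain ⟨hwv, hwV⟩ := Finset.mem_erase.1 hw
    rw [map_sub]
    linarith [hφ w (subset_convexHull ℝ _ hwV) hwv]
  obtain ⟨T, hTS, hST, hT⟩ := exists_exposed_generators S φ hSφ
  have hVT : ∀ w ∈ V, w - v ∈ Submodule.span ℝ≥0 (T : Set (Fin n → ℝ)) := by
    intro w hw
    by_cases h : w = v
    · simp [h]
    · exact hST (Finset.mem_image_of_mem _ (Finset.mem_erase.2 ⟨h, hw⟩))
  have hPT : ∀ x ∈ P, x - v ∈ Submodule.span ℝ≥0 (T : Set (Fin n → ℝ)) := by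
    have hsub : P ⊆ {x | x - v ∈ Submodule.span ℝ≥0 (T : Set (Fin n → ℝ))} := by
      refine convexHull_min hVT ?_
      intro x hx y hy a b ha hb hab
      rw [Set.mem_ofPred_eq] at hx hy ⊢
      have e : a • x + b • y - v = a • (x - v) + b • (y - v) := by
        obtain rfl : a = 1 - b := by linarith
        module
      rw [e]
      lift a to ℝ≥0 using ha
      lift b to ℝ≥0 using hb
      exact add_mem (Submodule.smul_mem _ a hx) (Submodule.smul_mem _ b hy)
    exact hsub
  have hgen : ∀ g ∈ T, 0 ≤ l g := by
    intro g hg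
    obtain ⟨f, hfg, hf⟩ := hT g hg
    have hTeq : insert g (T.erase g : Set (Fin n → ℝ)) = (T : Set (Fin n → ℝ)) := by
      rw [← Finset.coe_insert, Finset.insert_erase hg]
    have hf' : ∀ s ∈ (T.erase g : Set (Fin n → ℝ)), f s < 0 := by
      intro s hs
      obtain ⟨h1, h2⟩ := Finset.mem_erase.1 hs
      exact hf s h2 h1
    have hdec : ∀ x ∈ P, f x < f v ∨ ∃ a : ℝ, 0 ≤ a ∧ x = v + a • g := by
      intro x hx
      have := hPT x hx
      rw [← hTeq] at this
      obtain ⟨a, z, hz, hxa⟩ := Submodule.mem_span_insert.1 this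
      rcases neg_or_eq_zero_of_mem_span hf' hz with hz | rfl
      · left
        have h1 : f (x - v) = (a : ℝ) * f g + f z := by
          rw [hxa, map_add, NNReal.smul_def, map_smul, smul_eq_mul]
        rw [map_sub, hfg] at h1
        linarith
      · right
        refine ⟨a, a.2, ?_⟩
        rw [add_zero] at hxa
        rw [← sub_eq_iff_eq_add', hxa]
        rfl
    have hle : ∀ x ∈ P, f x ≤ f v := by
      intro x hx
      rcases hdec x hx with h | ⟨a, -, rfl⟩
      · exact h.le
      · simp [hfg]
    set K := {x ∈ P | ∀ y ∈ P, f y ≤ f x} with hK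
    have hvK : v ∈ K := ⟨hv.mem, hle⟩
    have hKdec : ∀ x ∈ K, ∃ a : ℝ, 0 ≤ a ∧ x = v + a • g := by
      intro x hx
      exact (hdec x hx.1).resolve_left (not_lt.2 (hx.2 v hv.mem))
    have hface : IsFaceOf P K := isFaceOf_of_clm P f
    obtain ⟨w, hw, hwg⟩ := Finset.mem_image.1 (hTS hg)
    obtain ⟨hwv, hwV⟩ := Finset.mem_erase.1 hw
    have hwK : w ∈ K := by
      refine ⟨subset_convexHull ℝ _ hwV, fun y hy => ?_⟩
      have : f w = f v := by
        rw [← sub_eq_zero, ← map_sub, hwg, hfg]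
      exact this ▸ hle y hy
    have hPcomp : IsCompact P := V.finite_toSet.isCompact_convexHull (𝕜 := ℝ)
    have hKcomp : IsCompact K := hface.isExposed.isCompact hPcomp
    obtain ⟨b, hb, hbmin⟩ := hKcomp.exists_isMinOn ⟨v, hvK⟩ φ.continuous.continuousOn
    have hφg := hSφ g (hTS hg)
    obtain ⟨β, hβ, rfl⟩ := hKdec b hb
    have hcoef : ∀ a : ℝ, v + a • g ∈ K → a ≤ β := by
      intro a ha
      have := hbmin ha
      simp only [Set.mem_ofPred_eq, map_add, map_smul, smul_eq_mul] at this
      by_contra! h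
      nlinarith
    have hwe : w = v + (1 : ℝ) • g := by rw [one_smul, ← hwg]; abel
    have hβ1 : 1 ≤ β := hcoef 1 (hwe ▸ hwK)
    have hg0 : g ≠ 0 := by
      rintro rfl
      simp at hφg
    have hKseg : K = segment ℝ v (v + β • g) := by
      apply Set.Subset.antisymm
      · intro x hx
        obtain ⟨a, ha, rfl⟩ := hKdec x hx
        have := hcoef a hx
        rw [segment_eq_image']
        refine ⟨a / β, ⟨by positivity, by rw [div_le_one (by linarith)]; exact this⟩, ?_⟩
        have hβ0 : β ≠ 0 := by linarith
        simp only [add_sub_cancel_left, smul_smul, div_mul_cancel₀ _ hβ0]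
      · exact (hface.isExposed.convex hPconv).segment_subset hvK hb
    have := hl K ⟨hface, v, v + β • g, by
      simpa [hg0] using (by linarith : β ≠ 0), hKseg⟩ hvK w hwK
    rw [← hwg, map_sub]
    linarith
  have hspan : ∀ y ∈ Submodule.span ℝ≥0 (T : Set (Fin n → ℝ)), 0 ≤ l y := by
    intro y hy
    induction hy using Submodule.span_induction with
    | mem x hx => exact hgen x hx
    | zero => simp
    | add x y _ _ hx hy => rw [map_add]; exact add_nonneg hx hy
    | smul a x _ hx =>
      rw [NNReal.smul_def, map_smul, smul_eq_mul]
      exact mul_nonneg a.2 hx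
  intro x hx
  have := hspan _ (hPT x hx)
  rw [map_sub] at this
  linarith

theorem right_mem_extremePoints_segment {E : Type*} [AddCommGroup E] [Module ℝ E] (a b : E) :
    b ∈ (segment ℝ a b).extremePoints ℝ := by
  rcases eq_or_ne a b with rfl | hab
  · simp
  refine mem_extremePoints_iff_left.2 ⟨right_mem_segment ℝ a b, ?_⟩
  intro x hx y hy hb
  rw [segment_eq_image'] at hx hy
  obtain ⟨s, ⟨hs0, hs1⟩, rfl⟩ := hx
  obtain ⟨t, ⟨ht0, ht1⟩, rfl⟩ := hy
  obtain ⟨p, q, hp, hq, hpq, he⟩ := hb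
  have h1 : (p * s + q * t - 1) • (b - a) = 0 := by
    obtain rfl : q = 1 - p := by linarith
    rw [← sub_eq_zero.2 he]
    module
  have h2 : p * s + q * t = 1 := by
    have := (smul_eq_zero.1 h1).resolve_right (sub_ne_zero.2 hab.symm)
    linarith
  have hs : s = 1 := by
    by_contra h
    have : s < 1 := lt_of_le_of_ne hs1 h
    nlinarith
  simp [hs]

/-- An edge of a polytope through a vertex `v` runs from `v` to another vertex. -/
theorem IsEdgeOf.exists_eq_segment {V : Finset (Fin n → ℝ)} {v : Fin n → ℝ}
    {E : Set (Fin n → ℝ)}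
    (hE : IsEdgeOf (convexHull ℝ (V : Set (Fin n → ℝ))) E)
    (hv : IsVertexOf (convexHull ℝ (V : Set (Fin n → ℝ))) v) (hvE : v ∈ E) :
    ∃ b, b ≠ v ∧ E = segment ℝ v b ∧ IsVertexOf (convexHull ℝ (V : Set (Fin n → ℝ))) b := by
  obtain ⟨hface, a, b, hab, rfl⟩ := hE
  have hext := hface.isExposed.isExtreme
  have hvext : v ∈ (segment ℝ a b).extremePoints ℝ :=
    inter_extremePoints_subset_extremePoints_of_subset hface.isExposed.subset
      ⟨hvE, hv.mem_extremePoints⟩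
  have hb := isVertexOf_of_mem_extremePoints
    (hext.extremePoints_subset_extremePoints (right_mem_extremePoints_segment a b))
  have ha := isVertexOf_of_mem_extremePoints (hext.extremePoints_subset_extremePoints
    (segment_symm ℝ a b ▸ right_mem_extremePoints_segment b a))
  have : v ∈ ({a, b} : Set (Fin n → ℝ)) := by
    rw [← convexHull_pair] at hvext
    exact extremePoints_convexHull_subset hvext
  rcases this with rfl | rfl
  · exact ⟨b, hab.symm, rfl, hb⟩
  · exact ⟨a, hab, segment_symm ℝ a v, ha⟩

end Edges

section Charts

variable {n : ℕ}

/-- An integer vector viewed as a real one. -/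
def latVec (d : Fin n → ℤ) : Fin n → ℝ := fun i => (d i : ℝ)

/-- `dotZ u` as a linear map. -/
def dotZLin (u : Fin n → ℤ) : (Fin n → ℝ) →ₗ[ℝ] ℝ where
  toFun := dotZ u
  map_add' x y := by simp [dotZ, mul_add, Finset.sum_add_distrib]
  map_smul' r x := by simp [dotZ, Finset.mul_sum, mul_left_comm]

@[simp]
theorem dotZLin_apply (u : Fin n → ℤ) (x : Fin n → ℝ) : dotZLin u x = dotZ u x := rfl

theorem dotZ_add (u : Fin n → ℤ) (x y : Fin n → ℝ) : dotZ u (x + y) = dotZ u x + dotZ u y :=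
  map_add (dotZLin u) x y

theorem dotZ_sub (u : Fin n → ℤ) (x y : Fin n → ℝ) : dotZ u (x - y) = dotZ u x - dotZ u y :=
  map_sub (dotZLin u) x y

theorem dotZ_smul (u : Fin n → ℤ) (r : ℝ) (x : Fin n → ℝ) : dotZ u (r • x) = r * dotZ u x :=
  map_smul (dotZLin u) r x

theorem dotZ_neg_left (u : Fin n → ℤ) (x : Fin n → ℝ) : dotZ (-u) x = -dotZ u x := by
  simp [dotZ]

theorem dotZ_sum_left {ι : Type*} (s : Finset ι) (u : ι → Fin n → ℤ) (x : Fin n → ℝ) :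
    dotZ (∑ i ∈ s, u i) x = ∑ i ∈ s, dotZ (u i) x := by
  simp only [dotZ, Finset.sum_apply, Int.cast_sum, Finset.sum_mul]
  exact Finset.sum_comm

theorem dotZ_smul_left (c : ℤ) (u : Fin n → ℤ) (x : Fin n → ℝ) :
    dotZ (c • u) x = c * dotZ u x := by
  simp [dotZ, Finset.mul_sum, mul_assoc]

theorem dotZ_latVec (u d : Fin n → ℤ) : dotZ u (latVec d) = ((u ⬝ᵥ d : ℤ) : ℝ) := by
  simp [dotZ, latVec, dotProduct]

theorem exists_clm_eq_dotZ (u : Fin n → ℤ) :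
    ∃ f : (Fin n → ℝ) →L[ℝ] ℝ, ∀ x, f x = dotZ u x :=
  exists_clm_eq_dotR (latVec u)

/-- The set of maximizers of `u` on `P`. -/
def maxFace (P : Set (Fin n → ℝ)) (u : Fin n → ℤ) : Set (Fin n → ℝ) :=
  {x ∈ P | ∀ y ∈ P, dotZ u y ≤ dotZ u x}

theorem isFaceOf_maxFace (P : Set (Fin n → ℝ)) (u : Fin n → ℤ) : IsFaceOf P (maxFace P u) :=
  ⟨latVec u, rfl⟩

/-- `u` is the primitive outer normal of a facet of `P`. -/
def IsOuterNormal (P : Set (Fin n → ℝ)) (u : Fin n → ℤ) : Prop :=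
  IsFacetNormal P (maxFace P u) u

theorem IsFacetNormal.isOuterNormal {P F : Set (Fin n → ℝ)} {u : Fin n → ℤ}
    (h : IsFacetNormal P F u) : IsOuterNormal P u := by
  have hF : F = maxFace P u := h.2.2
  rw [IsOuterNormal, ← hF]
  exact h

theorem IsReflexivePolytope.dotZ_le_one {P : Set (Fin n → ℝ)} (hP : IsReflexivePolytope P)
    {u : Fin n → ℤ} (hu : IsOuterNormal P u) {x : Fin n → ℝ} (hx : x ∈ P) : dotZ u x ≤ 1 := by
  obtain ⟨y, hy⟩ := hu.2.1.2.1
  exact (hy.2 x hx).trans_eq (hP.2 _ _ hu y hy)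

theorem IsReflexivePolytope.mem_maxFace_iff {P : Set (Fin n → ℝ)} (hP : IsReflexivePolytope P)
    {u : Fin n → ℤ} (hu : IsOuterNormal P u) {x : Fin n → ℝ} :
    x ∈ maxFace P u ↔ x ∈ P ∧ dotZ u x = 1 := by
  refine ⟨fun hx => ⟨hx.1, hP.2 _ _ hu x hx⟩, fun hx => ⟨hx.1, fun y hy => ?_⟩⟩
  exact (hP.dotZ_le_one hu hy).trans_eq hx.2.symm

theorem isPrimitiveZ_of_dotProduct_eq_one {u d : Fin n → ℤ} (h : u ⬝ᵥ d = 1) :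
    IsPrimitiveZ u := by
  have hdvd : Finset.univ.gcd u ∣ 1 := by
    rw [← h]
    exact Finset.dvd_sum fun i hi => Dvd.dvd.mul_right (Finset.gcd_dvd hi) _
  have := Finset.normalize_gcd (s := Finset.univ) (f := u)
  rw [IsPrimitiveZ, ← this]
  exact normalize_eq_one.2 (isUnit_of_dvd_one hdvd)

theorem dimSet_add_one {F : Set (Fin n → ℝ)} {q : Fin n → ℝ} {u : Fin n → ℤ}
    {d : Fin n → ℝ} (hud : dotZ u d ≠ 0) (hle : ∀ x ∈ F, dotZ u x = dotZ u q)
    (hge : ∀ y, dotZ u y = 0 → y ∈ vectorSpan ℝ F) : dimSet F + 1 = n := by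
  have hspan : vectorSpan ℝ F = LinearMap.ker (dotZLin u) := by
    apply le_antisymm
    · rw [vectorSpan_def, Submodule.span_le]
      rintro _ ⟨x, hx, y, hy, rfl⟩
      simp [dotZ_sub, hle x hx, hle y hy]
    · exact fun y hy => hge y hy
  have hrange : LinearMap.range (dotZLin u) = ⊤ := by
    refine LinearMap.range_eq_top.2 fun r => ⟨(r / dotZ u d) • d, ?_⟩
    rw [dotZLin_apply, dotZ_smul, div_mul_cancel₀ _ hud]
  have := LinearMap.finrank_range_add_finrank_ker (dotZLin u)
  rw [hrange, finrank_top, Module.finrank_self, Module.finrank_fin_fun, ← hspan] at this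
  rw [dimSet]
  omega

/-- Integral coordinates adapted to a vertex `v` of a monotone polytope `P`: the facets through
`v` have outer normals `-L i`, the edges at `v` have the dual primitive directions `D i`, and `a i`
is the lattice length of the `i`-th edge. -/
structure IsVertexChart (P : Set (Fin n → ℝ)) (v : Fin n → ℝ) (L D : Fin n → Fin n → ℤ)
    (a : Fin n → ℤ) : Prop where
  dual : ∀ i k, L i ⬝ᵥ D k = if i = k then 1 else 0
  lower : ∀ x ∈ P, ∀ i, -1 ≤ dotZ (L i) x
  base : ∀ i, dotZ (L i) v = -1
  length_pos : ∀ i, 0 < a i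
  neighbor : ∀ i, IsVertexOf P (v + (a i : ℝ) • latVec (D i))
  normal : ∀ i, IsOuterNormal P (-L i)
  complete : ∀ u, IsOuterNormal P u → dotZ u v = 1 → ∃ i, u = -L i

theorem sum_dual_mul {L D : Fin n → Fin n → ℤ}
    (h : ∀ i k, L i ⬝ᵥ D k = if i = k then 1 else 0) (i j : Fin n) :
    ∑ k, D k i * L k j = if i = j then 1 else 0 := by
  have h1 : Matrix.of L * (Matrix.of D).transpose = 1 := by
    ext i k
    simpa [Matrix.mul_apply, Matrix.one_apply, dotProduct] using h i k
  have h2 := congrArg (fun M => M i j) (mul_eq_one_comm.1 h1)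
  simpa [Matrix.mul_apply, Matrix.one_apply] using h2

theorem eq_sum_smul_of_dual {L D : Fin n → Fin n → ℤ}
    (h : ∀ i k, L i ⬝ᵥ D k = if i = k then 1 else 0) (u : Fin n → ℤ) :
    u = ∑ k, (u ⬝ᵥ D k) • L k := by
  ext j
  simp only [Finset.sum_apply, Pi.smul_apply, smul_eq_mul, dotProduct, Finset.sum_mul]
  rw [Finset.sum_comm]
  simp [mul_assoc, ← Finset.mul_sum, sum_dual_mul h]

theorem eq_sum_smul_latVec_of_dual {L D : Fin n → Fin n → ℤ}
    (h : ∀ i k, L i ⬝ᵥ D k = if i = k then 1 else 0) (x : Fin n → ℝ) :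
    x = ∑ k, dotZ (L k) x • latVec (D k) := by
  ext i
  simp only [Finset.sum_apply, Pi.smul_apply, smul_eq_mul, dotZ, Finset.sum_mul, latVec]
  rw [Finset.sum_comm]
  have : ∀ j, ∑ k, (L k j : ℝ) * x j * (D k i : ℝ) = if i = j then x j else 0 := by
    intro j
    have := congrArg (Int.cast : ℤ → ℝ) (sum_dual_mul h i j)
    push_cast at this
    calc _ = (∑ k, (D k i : ℝ) * (L k j : ℝ)) * x j := by
          rw [Finset.sum_mul]
          exact Finset.sum_congr rfl fun k _ => by ring
      _ = _ := by rw [this]; simp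
  simp [this]

theorem eq_sum_smul_of_dual' {L D : Fin n → Fin n → ℤ}
    (h : ∀ i k, L i ⬝ᵥ D k = if i = k then 1 else 0) (d : Fin n → ℤ) :
    d = ∑ k, (L k ⬝ᵥ d) • D k := by
  simp only [fun k => dotProduct_comm (L k) d]
  exact eq_sum_smul_of_dual (L := D) (D := L)
    (fun i k => by rw [dotProduct_comm, h]; simp only [eq_comm]) d

theorem IsMonotonePolytope.exists_isVertexChart {P : Set (Fin n → ℝ)} (hP : IsMonotonePolytope P)
    {v : Fin n → ℝ} (hv : IsVertexOf P v) : ∃ L D a, IsVertexChart P v L D a := by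
  obtain ⟨⟨V, hVlat, rfl, -⟩, hsmooth, hrefl⟩ := hP
  set P := convexHull ℝ (V : Set (Fin n → ℝ)) with hPdef
  obtain ⟨⟨Fs, hFinj, hFs, hFall⟩, E, D, -, hE, hEall, hdet⟩ := hsmooth v hv
  obtain ⟨L, hdual⟩ : ∃ L : Fin n → Fin n → ℤ, ∀ i k, L i ⬝ᵥ D k = if i = k then 1 else 0 := by
    refine ⟨((Matrix.of D)⁻¹).transpose, fun i k => ?_⟩
    have := congrFun (congrFun (Matrix.mul_nonsing_inv (Matrix.of D) hdet) k) i
    rw [Matrix.mul_apply, Matrix.one_apply] at this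
    rw [dotProduct_comm]
    simp only [eq_comm (a := i)]
    exact this
  have hdualR : ∀ i k, dotZ (L i) (latVec (D k)) = if i = k then 1 else 0 := by
    intro i k
    rw [dotZ_latVec, hdual]
    split_ifs <;> simp
  have hvert : ∀ w, IsVertexOf P w → IsLatticePt w := fun w hw =>
    hVlat w (extremePoints_convexHull_subset hw.mem_extremePoints)
  have hedge : ∀ i, ∃ t : ℤ, 0 < t ∧ E i = segment ℝ v (v + (t : ℝ) • latVec (D i)) ∧
      IsVertexOf P (v + (t : ℝ) • latVec (D i)) := by
    intro i
    obtain ⟨hEi, hvE, -, w, hw, t, ht, hwt⟩ := hE i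
    obtain ⟨b, -, hEb, hb⟩ := hEi.exists_eq_segment hv hvE
    have hwv : w - v = t • latVec (D i) := funext hwt
    rw [hEb, segment_eq_image'] at hw
    obtain ⟨s, ⟨hs0, -⟩, rfl⟩ := hw
    rw [add_sub_cancel_left] at hwv
    have hts : t = s * dotZ (L i) (b - v) := by
      have := congrArg (dotZ (L i)) hwv
      rw [dotZ_smul, dotZ_smul, hdualR, if_pos rfl, mul_one] at this
      exact this.symm
    have hs : 0 < s := hs0.lt_of_ne (by rintro rfl; simp at hts; exact ht.ne' hts)
    have hbv : b = v + dotZ (L i) (b - v) • latVec (D i) := by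
      rw [hts, mul_smul] at hwv
      rw [← smul_right_injective _ hs.ne' hwv]
      abel
    obtain ⟨m, hm⟩ : ∃ m : ℤ, dotZ (L i) (b - v) = m := by
      choose bz hbz using hvert b hb
      choose vz hvz using hvert v hv
      have : b - v = latVec (bz - vz) := by
        ext j
        simp [latVec, hbz, hvz]
      exact ⟨_, by rw [this, dotZ_latVec]⟩
    rw [hm] at hts hbv
    refine ⟨m, ?_, hbv ▸ hEb, hbv ▸ hb⟩
    have : (0 : ℝ) < m := by
      by_contra! h
      nlinarith
    exact_mod_cast this
  choose a ha hEa hnb using hedge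
  have hmin : ∀ i, ∀ x ∈ P, dotZ (L i) v ≤ dotZ (L i) x := by
    intro i
    obtain ⟨l, hl⟩ := exists_clm_eq_dotZ (L i)
    simp only [← hl]
    refine le_of_forall_edge_le hv l fun E' hE' hvE' x hx => ?_
    obtain ⟨k, rfl⟩ := hEall E' hE' hvE'
    rw [hEa k, segment_eq_image'] at hx
    obtain ⟨s, ⟨hs, -⟩, rfl⟩ := hx
    have hak : (0 : ℝ) < a k := by exact_mod_cast ha k
    simp only [hl, add_sub_cancel_left, dotZ_add, dotZ_smul, hdualR]
    split_ifs
    · have : 0 ≤ s * (a k * 1) := by positivity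
      linarith
    · simp
  have hmem : ∀ i x, x ∈ maxFace P (-L i) ↔ x ∈ P ∧ dotZ (L i) x = dotZ (L i) v := by
    intro i x
    simp only [maxFace, Set.mem_ofPred_eq, dotZ_neg_left, neg_le_neg_iff]
    refine and_congr_right fun hx => ⟨fun h => le_antisymm (h v hv.mem) (hmin i x hx), ?_⟩
    exact fun h y hy => h ▸ hmin i y hy
  have hnbmem : ∀ i k, v + (a k : ℝ) • latVec (D k) ∈ maxFace P (-L i) ↔ i ≠ k := by
    intro i k
    have hak : (a k : ℝ) ≠ 0 := by exact_mod_cast (ha k).ne'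
    rw [hmem, and_iff_right (hnb k).mem, dotZ_add, dotZ_smul, hdualR]
    by_cases h : i = k <;> simp [h, (ha k).ne']
  have hnormal : ∀ i, IsOuterNormal P (-L i) := by
    intro i
    refine ⟨isPrimitiveZ_of_dotProduct_eq_one (d := -D i) (by simp [hdual]),
      ⟨isFaceOf_maxFace _ _, ⟨v, (hmem i v).2 ⟨hv.mem, rfl⟩⟩, ?_⟩, rfl⟩
    refine dimSet_add_one (q := v) (u := L i) (d := latVec (D i)) (by simp [hdualR])
      (fun x hx => ((hmem i x).1 hx).2) fun y hy => ?_
    rw [eq_sum_smul_latVec_of_dual hdual y]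
    refine sum_mem fun k _ => ?_
    by_cases hik : i = k
    · subst hik
      simp [hy]
    · have hak : (a k : ℝ) ≠ 0 := by exact_mod_cast (ha k).ne'
      have := vsub_mem_vectorSpan ℝ ((hnbmem i k).2 hik) ((hmem i v).2 ⟨hv.mem, rfl⟩)
      rw [vsub_eq_sub, add_sub_cancel_left] at this
      have := Submodule.smul_mem _ (dotZ (L k) y / a k) this
      rwa [smul_smul, div_mul_cancel₀ _ hak] at this
  have hbase : ∀ i, dotZ (L i) v = -1 := by
    intro i
    have := hrefl.2 _ _ (hnormal i) v ((hmem i v).2 ⟨hv.mem, rfl⟩)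
    rw [dotZ_neg_left] at this
    linarith
  refine ⟨L, D, a, hdual, fun x hx i => hbase i ▸ hmin i x hx, hbase, ha, hnb, hnormal, ?_⟩
  intro u hu huv
  choose σ hσ using fun i => hFall (maxFace P (-L i)) (hnormal i).2.1
    ((hmem i v).2 ⟨hv.mem, rfl⟩)
  have hσinj : Function.Injective σ := by
    intro i k hik
    by_contra hne
    have h1 : maxFace P (-L i) = maxFace P (-L k) := by rw [hσ, hσ, hik]
    exact (hnbmem k k).1 (h1 ▸ (hnbmem i k).2 hne) rfl
  obtain ⟨k, hk⟩ := hFall (maxFace P u) hu.2.1 ((hrefl.mem_maxFace_iff hu).2 ⟨hv.mem, huv⟩)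
  obtain ⟨i, rfl⟩ := (Finite.injective_iff_surjective.1 hσinj) k
  rw [← hσ] at hk
  have hzero : ∀ k, k ≠ i → u ⬝ᵥ D k = 0 := by
    intro k hki
    have h1 := ((hrefl.mem_maxFace_iff hu).1 (hk ▸ (hnbmem i k).2 hki.symm)).2
    rw [dotZ_add, huv, dotZ_smul, dotZ_latVec] at h1
    have hak : (a k : ℝ) ≠ 0 := by exact_mod_cast (ha k).ne'
    have : (a k : ℝ) * ((u ⬝ᵥ D k : ℤ) : ℝ) = 0 := by linarith
    exact_mod_cast (mul_eq_zero.1 this).resolve_left hak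
  have hu' : u = (u ⬝ᵥ D i) • L i := by
    conv_lhs => rw [eq_sum_smul_of_dual hdual u]
    refine Finset.sum_eq_single i (fun k _ hk => by rw [hzero k hk, zero_smul]) (by simp)
  have hc : u ⬝ᵥ D i = -1 := by
    rw [hu', dotZ_smul_left, hbase] at huv
    have : ((u ⬝ᵥ D i : ℤ) : ℝ) = -1 := by linarith
    exact_mod_cast this
  exact ⟨i, by rw [hu', hc, neg_one_smul]⟩

end Charts

section Adjacent

variable {n : ℕ} {P : Set (Fin n → ℝ)} {v : Fin n → ℝ} {L D : Fin n → Fin n → ℤ} {a : Fin n → ℤ}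

theorem IsMonotonePolytope.convex (hP : IsMonotonePolytope P) : Convex ℝ P := by
  obtain ⟨V, -, rfl, -⟩ := hP.1
  exact convex_convexHull ℝ _

theorem IsVertexChart.dotZ_direction (hC : IsVertexChart P v L D a) (i k : Fin n) :
    dotZ (L i) (latVec (D k)) = if i = k then 1 else 0 := by
  rw [dotZ_latVec, hC.dual]
  split_ifs <;> simp

theorem IsVertexChart.dotZ_neighbor (hC : IsVertexChart P v L D a) (i k : Fin n) :
    dotZ (L i) (v + (a k : ℝ) • latVec (D k)) = -1 + if i = k then (a k : ℝ) else 0 := by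
  rw [dotZ_add, dotZ_smul, hC.base, hC.dotZ_direction]
  simp

/-- The chart at a vertex adjacent to `v` shares all but one of its facets with the chart at `v`. -/
theorem IsVertexChart.exists_adjacent (hC : IsVertexChart P v L D a)
    (hP : IsMonotonePolytope P) (j : Fin n) :
    ∃ L' D' a', IsVertexChart P (v + (a j : ℝ) • latVec (D j)) L' D' a' ∧
      ∀ i ≠ j, L' i = L i := by
  obtain ⟨L', D', a', hC'⟩ := hP.exists_isVertexChart (hC.neighbor j)
  have hex : ∀ i, ∃ s, i ≠ j → L' s = L i := by
    intro i
    by_cases hij : i = j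
    · exact ⟨i, fun h => absurd hij h⟩
    · obtain ⟨s, hs⟩ := hC'.complete (-L i) (hC.normal i)
        (by rw [dotZ_neg_left, hC.dotZ_neighbor, if_neg hij]; simp)
      exact ⟨s, fun _ => (neg_injective hs).symm⟩
  choose σ hσ using hex
  obtain ⟨τ, hτ⟩ : ∃ τ, τ ∉ (Finset.univ.erase j).image σ := by
    by_contra! h
    have h1 := Finset.card_le_card (fun x _ => h x : Finset.univ ⊆ (Finset.univ.erase j).image σ)
    have h2 := Finset.card_erase_lt_of_mem (Finset.mem_univ j)
    exact absurd (h1.trans Finset.card_image_le) (not_le.2 h2)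
  have hτ' : ∀ i, i ≠ j → σ i ≠ τ := fun i hi h =>
    hτ (Finset.mem_image.2 ⟨i, Finset.mem_erase.2 ⟨hi, Finset.mem_univ _⟩, h⟩)
  set e : Fin n → Fin n := fun i => if i = j then τ else σ i with he
  have hinj : Function.Injective e := by
    intro i k hik
    by_cases hi : i = j <;> by_cases hk : k = j
    · rw [hi, hk]
    · simp only [he, if_pos hi, if_neg hk] at hik
      exact absurd hik.symm (hτ' k hk)
    · simp only [he, if_neg hi, if_pos hk] at hik
      exact absurd hik (hτ' i hi)
    · simp only [he, if_neg hi, if_neg hk] at hik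
      have hL : L i = L k := by rw [← hσ i hi, hik, hσ k hk]
      by_contra hne
      have h1 := hC.dual i i
      rw [hL, hC.dual] at h1
      simp [Ne.symm hne] at h1
  refine ⟨L' ∘ e, D' ∘ e, a' ∘ e, ⟨fun i k => ?_, fun x hx i => hC'.lower x hx _,
    fun i => hC'.base _, fun i => hC'.length_pos _, fun i => hC'.neighbor _,
    fun i => hC'.normal _, fun u hu huv => ?_⟩, fun i hi => ?_⟩
  · simp [hC'.dual, hinj.eq_iff]
  · obtain ⟨s, rfl⟩ := hC'.complete u hu huv
    obtain ⟨i, rfl⟩ := (Finite.injective_iff_surjective.1 hinj) s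
    exact ⟨i, rfl⟩
  · simp [he, hi, hσ i hi]

/-- The facet of `P` through the neighbor of `v` in direction `j` that does not contain `v`. -/
theorem IsVertexChart.exists_opposite_normal (hC : IsVertexChart P v L D a)
    (hP : IsMonotonePolytope P) (hv : v ∈ P) (j : Fin n) :
    ∃ U : Fin n → ℤ, IsOuterNormal P U ∧ U ⬝ᵥ D j = 1 ∧
      dotZ U (v + (a j : ℝ) • latVec (D j)) = 1 ∧
      (∀ u, IsOuterNormal P u → dotZ u (v + (a j : ℝ) • latVec (D j)) = 1 →
        u = U ∨ ∃ i, u = -L i) ∧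
      ∀ i ≠ j, v + (a j : ℝ) • latVec (D j) + latVec (D i - (U ⬝ᵥ D i) • D j) ∈ P := by
  obtain ⟨L', D', a', hC', hL⟩ := hC.exists_adjacent hP j
  have hDj : D' j = (L j ⬝ᵥ D' j) • D j := by
    conv_lhs => rw [eq_sum_smul_of_dual' hC.dual (D' j)]
    refine Finset.sum_eq_single j (fun k _ hk => ?_) (by simp)
    rw [← hL k hk, hC'.dual, if_neg hk, zero_smul]
  have hunit : (L j ⬝ᵥ D' j) * (L' j ⬝ᵥ D j) = 1 := by
    have := hC'.dual j j
    rwa [if_pos rfl, hDj, dotProduct_smul, smul_eq_mul] at this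
  have hsign : L' j ⬝ᵥ D j ≤ 0 := by
    have h1 := hC'.base j
    have h2 := hC'.lower v hv j
    rw [dotZ_add, dotZ_smul, dotZ_latVec] at h1
    have ha : (0 : ℝ) < a j := by exact_mod_cast hC.length_pos j
    have : ((L' j ⬝ᵥ D j : ℤ) : ℝ) ≤ 0 := by
      by_contra! h
      nlinarith
    exact_mod_cast this
  have hval : L' j ⬝ᵥ D j = -1 := by
    rcases Int.isUnit_iff.1 (IsUnit.of_mul_eq_one_right _ hunit) with h | h
    · omega
    · exact h
  refine ⟨-L' j, hC'.normal j, by simp [hval], ?_, fun u hu huv => ?_, fun i hi => ?_⟩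
  · rw [dotZ_neg_left, hC'.base, neg_neg]
  · obtain ⟨i, rfl⟩ := hC'.complete u hu huv
    by_cases hi : i = j
    · exact .inl (by rw [hi])
    · exact .inr ⟨i, by rw [hL i hi]⟩
  · have hDi : D' i = D i + (L j ⬝ᵥ D' i) • D j := by
      conv_lhs => rw [eq_sum_smul_of_dual' hC.dual (D' i), ← Finset.sum_erase_add _ _
        (Finset.mem_univ j)]
      congr 1
      rw [Finset.sum_eq_single i]
      · rw [← hL i hi, hC'.dual, if_pos rfl, one_smul]
      · intro k hk hki
        rw [← hL k (Finset.ne_of_mem_erase hk), hC'.dual, if_neg hki, zero_smul]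
      · simp [hi]
    have he : L' j ⬝ᵥ D i = L j ⬝ᵥ D' i := by
      have := hC'.dual j i
      rw [if_neg hi.symm, hDi, dotProduct_add, dotProduct_smul, hval, smul_eq_mul] at this
      linarith
    have hD' : D i - (-L' j ⬝ᵥ D i) • D j = D' i := by
      rw [neg_dotProduct, he, neg_smul, sub_neg_eq_add, ← hDi]
    rw [hD']
    have ha1 : (1 : ℝ) ≤ a' i := by exact_mod_cast hC'.length_pos i
    have hmem := hP.convex.add_smul_mem (hC.neighbor j).mem (hC'.neighbor i).mem
      (t := (a' i : ℝ)⁻¹) ⟨by positivity, inv_le_one_of_one_le₀ ha1⟩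
    rwa [inv_smul_smul₀ (by positivity)] at hmem

theorem IsVertexChart.centralNormal_eq (hC : IsVertexChart P v L D a) (hP : IsReflexivePolytope P)
    (hv : v ∈ P) {u : Fin n → ℤ} (hu : IsCentralNormal P {v} u) : u = -∑ i, L i := by
  obtain ⟨m, Fs, us, hinj, hFs, hall, rfl⟩ := hu
  have hval : ∀ i, dotZ (us i) v = 1 := fun i =>
    hP.2 _ _ (hFs i).2 v ((hFs i).1 (Set.mem_singleton v))
  choose σ hσ using fun i => hC.complete (us i) (hFs i).2.isOuterNormal (hval i)
  have hFσ : ∀ i, Fs i = maxFace P (-L (σ i)) := fun i => hσ i ▸ (hFs i).2.2.2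
  have hbij : Function.Bijective σ := by
    refine ⟨fun i k hik => hinj (by rw [hFσ, hFσ, hik]), fun k => ?_⟩
    obtain ⟨i, hi⟩ := hall (maxFace P (-L k)) (hC.normal k).2.1
      (Set.singleton_subset_iff.2 ((hP.mem_maxFace_iff (hC.normal k)).2
        ⟨hv, by rw [dotZ_neg_left, hC.base, neg_neg]⟩))
    refine ⟨i, ?_⟩
    by_contra hne
    have hmem : v + (a k : ℝ) • latVec (D k) ∈ maxFace P (-L k) := by
      rw [hi, hFσ, hP.mem_maxFace_iff (hC.normal _), dotZ_neg_left, hC.dotZ_neighbor, if_neg hne]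
      exact ⟨(hC.neighbor k).mem, by simp⟩
    have h := ((hP.mem_maxFace_iff (hC.normal _)).1 hmem).2
    rw [dotZ_neg_left, hC.dotZ_neighbor, if_pos rfl] at h
    have ha : (0 : ℝ) < a k := by exact_mod_cast hC.length_pos k
    linarith
  rw [Finset.sum_congr rfl fun i _ => hσ i, hbij.sum_comp fun k => -L k, Finset.sum_neg_distrib]

end Adjacent

section Arithmetic

variable {n : ℕ} {c : Fin n → Fin n → ℤ} {a : Fin n → ℤ}

theorem coefficient_dichotomy (hn : 0 < n) (hsum : ∀ j, ∑ k, c j k = a j - 1)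
    (hle : ∀ j k, a k * c j k ≤ a j) (ha : ∀ k, (n : ℤ) ≤ a k) (hdiag : ∀ j, c j j = 1) :
    ∃ j, (∀ k, c j k = 1 ∧ a k = n + 1) ∨
      ∃ k₀, a j = n ∧ c j k₀ = 0 ∧ ∀ k ≠ k₀, c j k = 1 ∧ a k = n := by
  obtain ⟨j, -, hj⟩ := Finset.exists_min_image Finset.univ a ⟨⟨0, hn⟩, Finset.mem_univ _⟩
  have hpos : ∀ k, 0 < a k := fun k => by have := ha k; omega
  have hc : ∀ k, c j k ≤ 1 := by
    intro k
    by_contra! h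
    nlinarith [hj k (Finset.mem_univ k), hle j k, hpos k, hpos j]
  have htot : ∑ k, (1 - c j k) = n + 1 - a j := by
    rw [Finset.sum_sub_distrib, hsum]
    simp
    ring
  refine ⟨j, ?_⟩
  by_cases hall : ∀ k, c j k = 1
  · left
    have haj : a j = n + 1 := by simp [hall] at htot; omega
    refine fun k => ⟨hall k, le_antisymm ?_ (haj ▸ hj k (Finset.mem_univ k))⟩
    have := hle j k
    rwa [hall, mul_one, haj] at this
  · right
    push Not at hall
    obtain ⟨k₀, hk₀⟩ := hall
    have h0 : c j k₀ ≤ 0 := by have := hc k₀; omega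
    have hbound : ∀ k ≠ k₀, (1 - c j k₀) + (1 - c j k) ≤ n + 1 - a j := by
      intro k hk
      rw [← htot, ← Finset.add_sum_erase _ _ (Finset.mem_univ k₀)]
      gcongr
      exact Finset.single_le_sum (f := fun k => 1 - c j k) (fun i _ => by have := hc i; omega)
        (Finset.mem_erase.2 ⟨hk, Finset.mem_univ _⟩)
    have hjk : j ≠ k₀ := by
      rintro rfl
      exact hk₀ (hdiag j)
    have hj' := hbound j hjk
    rw [hdiag] at hj'
    have haj : a j = n := by have := ha j; omega
    refine ⟨k₀, haj, by have := ha j; omega, fun k hk => ?_⟩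
    have hck : c j k = 1 := by have := hbound k hk; have := hc k; have := ha j; omega
    have := hle j k
    rw [hck] at this
    have := ha k
    exact ⟨hck, by omega⟩

theorem coefficient_eq_one (hn : 3 ≤ n) {b : Fin n → ℤ} {k₀ : Fin n} {m : ℤ}
    (hsum : ∑ k, b k = m - 1) (hm : (n : ℤ) ≤ m) (hb₀ : b k₀ = 1)
    (hb : ∀ k ≠ k₀, n * b k ≤ m - 1) : m = n + 1 ∧ ∀ k, b k = 1 := by
  have hcard : ((Finset.univ.erase k₀).card : ℤ) = n - 1 := by
    rw [Finset.card_erase_of_mem (Finset.mem_univ _), Finset.card_univ, Fintype.card_fin]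
    omega
  have hsum' : ∑ k ∈ Finset.univ.erase k₀, b k = m - 2 := by
    rw [← Finset.add_sum_erase _ _ (Finset.mem_univ k₀), hb₀] at hsum
    omega
  have h1 : (n : ℤ) * (m - 2) ≤ (n - 1) * (m - 1) := by
    rw [← hsum', Finset.mul_sum, ← hcard, ← nsmul_eq_mul]
    exact Finset.sum_le_card_nsmul _ _ _ fun k hk => hb k (Finset.ne_of_mem_erase hk)
  have hm' : m ≤ n + 1 := by linarith
  have hm1 : m = n + 1 := by
    by_contra hne
    have hmn : m = n := by omega
    have : ∑ k ∈ Finset.univ.erase k₀, b k ≤ 0 := by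
      refine Finset.sum_nonpos fun k hk => ?_
      have := hb k (Finset.ne_of_mem_erase hk)
      by_contra! h
      nlinarith
    omega
  refine ⟨hm1, ?_⟩
  have hb1 : ∀ k ∈ Finset.univ.erase k₀, 0 ≤ 1 - b k := by
    intro k hk
    have := hb k (Finset.ne_of_mem_erase hk)
    by_contra! h
    nlinarith
  have hzero : ∑ k ∈ Finset.univ.erase k₀, (1 - b k) = 0 := by
    rw [Finset.sum_sub_distrib, hsum', Finset.sum_const, nsmul_eq_mul, hcard, hm1]
    ring
  intro k
  by_cases hk : k = k₀
  · rw [hk, hb₀]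
  · have := (Finset.sum_eq_zero_iff_of_nonneg hb1).1 hzero k (Finset.mem_erase.2 ⟨hk, by simp⟩)
    omega

end Arithmetic

section Simplex

variable {n : ℕ}

theorem dotZ_one (x : Fin n → ℝ) : dotZ 1 x = ∑ i, x i := by
  simp [dotZ]

theorem dotZ_single (k : Fin n) (x : Fin n → ℝ) : dotZ (Pi.single k 1) x = x k := by
  simp [dotZ, Pi.single_apply]

theorem mem_maxFace_iff_of_le {P : Set (Fin n → ℝ)} {u : Fin n → ℤ} {q : Fin n → ℝ} (hq : q ∈ P)
    (hle : ∀ y ∈ P, dotZ u y ≤ dotZ u q) {x : Fin n → ℝ} :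
    x ∈ maxFace P u ↔ x ∈ P ∧ dotZ u x = dotZ u q :=
  and_congr_right fun hx => ⟨fun h => le_antisymm (hle x hx) (h q hq), fun h y hy => h ▸ hle y hy⟩

theorem mem_vectorSpan_of_add_smul_mem {F : Set (Fin n → ℝ)} {q y : Fin n → ℝ} {ε : ℝ} (hε : 0 < ε)
    (hq : q ∈ F) (hqy : q + ε • y ∈ F) : y ∈ vectorSpan ℝ F := by
  have h := vsub_mem_vectorSpan ℝ hqy hq
  rw [vsub_eq_sub, add_sub_cancel_left] at h
  simpa [smul_smul, inv_mul_cancel₀ hε.ne'] using Submodule.smul_mem _ ε⁻¹ h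

theorem exists_small_smul (y : Fin n → ℝ) :
    ∃ ε : ℝ, 0 < ε ∧ (∀ i, -1 ≤ ε * y i) ∧ ε * ∑ i, y i ≤ 1 := by
  set M := ∑ i, |y i| + 1
  have hM : 0 < M := by positivity
  have hle : ∀ i, |y i| ≤ M := fun i =>
    (Finset.single_le_sum (f := fun i => |y i|) (fun _ _ => abs_nonneg _)
      (Finset.mem_univ i)).trans (by simp [M])
  refine ⟨M⁻¹, inv_pos.2 hM, fun i => ?_, ?_⟩
  · rw [inv_mul_eq_div, le_div_iff₀ hM]
    linarith [neg_abs_le (y i), hle i]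
  · rw [inv_mul_eq_div, div_le_one hM]
    have := (le_abs_self _).trans (Finset.abs_sum_le_sum_abs y Finset.univ)
    linarith

/-- The vertex of the monotone simplex with `Σ i, x i = 1` on the `k`-th coordinate axis. -/
def simplexVertex (k : Fin n) : Fin n → ℝ := fun i => -1 + if i = k then (n + 1 : ℝ) else 0

theorem sum_simplexVertex (k : Fin n) : ∑ i, simplexVertex k i = 1 := by
  simp [simplexVertex, Finset.sum_add_distrib]

theorem simplexVertex_of_ne {i k : Fin n} (h : i ≠ k) : simplexVertex k i = -1 := by
  simp [simplexVertex, h]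

theorem simplexVertex_mem (k : Fin n) : simplexVertex k ∈ monotoneSimplex n := by
  refine ⟨fun i => ?_, (sum_simplexVertex k).le⟩
  rw [simplexVertex]
  split_ifs
  · have : (0 : ℝ) ≤ n := by positivity
    linarith
  · simp

theorem mem_maxFace_simplex_one [NeZero n] {x : Fin n → ℝ} :
    x ∈ maxFace (monotoneSimplex n) 1 ↔ x ∈ monotoneSimplex n ∧ ∑ i, x i = 1 := by
  rw [mem_maxFace_iff_of_le (simplexVertex_mem 0), dotZ_one, dotZ_one, sum_simplexVertex]
  intro y hy
  rw [dotZ_one, dotZ_one, sum_simplexVertex]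
  exact hy.2

theorem mem_maxFace_simplex_neg_single {j k : Fin n} (hjk : j ≠ k) {x : Fin n → ℝ} :
    x ∈ maxFace (monotoneSimplex n) (-Pi.single k 1) ↔ x ∈ monotoneSimplex n ∧ x k = -1 := by
  rw [mem_maxFace_iff_of_le (simplexVertex_mem j), dotZ_neg_left, dotZ_neg_left, dotZ_single,
    dotZ_single, simplexVertex_of_ne hjk.symm, neg_inj]
  intro y hy
  rw [dotZ_neg_left, dotZ_neg_left, dotZ_single, dotZ_single, simplexVertex_of_ne hjk.symm,
    neg_le_neg_iff]
  exact hy.1 k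

theorem dotZ_neg_single_add_one (k : Fin n) (x : Fin n → ℝ) :
    dotZ (-Pi.single k 1 + 1) x = ∑ i, x i - x k := by
  have : dotZ (-Pi.single k 1 + 1) x = dotZ (-Pi.single k 1) x + dotZ 1 x := by
    simp [dotZ, add_mul, Finset.sum_add_distrib]
  rw [this, dotZ_neg_left, dotZ_single, dotZ_one]
  ring

theorem mem_maxFace_simplex_codim_two {j k : Fin n} (hjk : j ≠ k) {x : Fin n → ℝ} :
    x ∈ maxFace (monotoneSimplex n) (-Pi.single k 1 + 1) ↔
      x ∈ monotoneSimplex n ∧ ∑ i, x i = 1 ∧ x k = -1 := by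
  rw [mem_maxFace_iff_of_le (simplexVertex_mem j)]
  · rw [dotZ_neg_single_add_one, dotZ_neg_single_add_one, sum_simplexVertex,
      simplexVertex_of_ne hjk.symm]
    refine and_congr_right fun hx => ⟨fun h => ?_, fun h => by rw [h.1, h.2]⟩
    have h1 := hx.1 k
    have h2 := hx.2
    constructor <;> linarith
  · intro y hy
    rw [dotZ_neg_single_add_one, dotZ_neg_single_add_one, sum_simplexVertex,
      simplexVertex_of_ne hjk.symm]
    have h1 := hy.1 k
    have h2 := hy.2
    linarith

theorem isFacetNormal_simplex_one [NeZero n] :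
    IsFacetNormal (monotoneSimplex n) (maxFace (monotoneSimplex n) 1) 1 := by
  refine ⟨isPrimitiveZ_of_dotProduct_eq_one (d := Pi.single 0 1) (by simp),
    ⟨isFaceOf_maxFace _ _, ⟨simplexVertex 0, mem_maxFace_simplex_one.2
      ⟨simplexVertex_mem 0, sum_simplexVertex 0⟩⟩, ?_⟩, rfl⟩
  have hn : (n : ℝ) ≠ 0 := Nat.cast_ne_zero.2 (NeZero.ne n)
  refine dimSet_add_one (u := 1) (q := simplexVertex 0) (d := Pi.single 0 1)
    (by simp [dotZ_one]) (fun x hx => ?_) fun y hy => ?_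
  · rw [dotZ_one, dotZ_one, (mem_maxFace_simplex_one.1 hx).2, sum_simplexVertex]
  · rw [dotZ_one] at hy
    obtain ⟨ε, hε, hy1, -⟩ := exists_small_smul y
    have hinv : (0 : ℝ) ≤ (n : ℝ)⁻¹ := by positivity
    have hmem : ∀ r : ℝ, (∀ i, -1 ≤ r * y i) →
        (fun _ => (n : ℝ)⁻¹ : Fin n → ℝ) + r • y ∈ maxFace (monotoneSimplex n) 1 := by
      intro r hr
      have hs : ∑ i, ((fun _ => (n : ℝ)⁻¹ : Fin n → ℝ) + r • y) i = 1 := by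
        simp [Finset.sum_add_distrib, ← Finset.mul_sum, hy, hn]
      refine mem_maxFace_simplex_one.2 ⟨⟨fun i => ?_, hs.le⟩, hs⟩
      have := hr i
      simp only [Pi.add_apply, Pi.smul_apply, smul_eq_mul]
      linarith
    exact mem_vectorSpan_of_add_smul_mem hε (by simpa using hmem 0 (by simp)) (hmem ε hy1)

theorem isFacetNormal_simplex_neg_single {j k : Fin n} (hjk : j ≠ k) :
    IsFacetNormal (monotoneSimplex n) (maxFace (monotoneSimplex n) (-Pi.single k 1))
      (-Pi.single k 1) := by
  refine ⟨isPrimitiveZ_of_dotProduct_eq_one (d := -Pi.single k 1) (by simp),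
    ⟨isFaceOf_maxFace _ _, ⟨simplexVertex j, (mem_maxFace_simplex_neg_single hjk).2
      ⟨simplexVertex_mem j, simplexVertex_of_ne hjk.symm⟩⟩, ?_⟩, rfl⟩
  refine dimSet_add_one (u := Pi.single k 1) (q := simplexVertex j) (d := Pi.single k 1)
    (by simp [dotZ_single]) (fun x hx => ?_) fun y hy => ?_
  · rw [dotZ_single, dotZ_single, ((mem_maxFace_simplex_neg_single hjk).1 hx).2,
      simplexVertex_of_ne hjk.symm]
  · rw [dotZ_single] at hy
    obtain ⟨ε, hε, hy1, hy2⟩ := exists_small_smul y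
    have hmem : ∀ r : ℝ, (∀ i, -1 ≤ r * y i) → r * ∑ i, y i ≤ 1 →
        (-Pi.single k 1 : Fin n → ℝ) + r • y ∈
          maxFace (monotoneSimplex n) (-Pi.single k 1) := by
      intro r hr hrs
      refine (mem_maxFace_simplex_neg_single hjk).2 ⟨⟨fun i => ?_, ?_⟩, by simp [hy]⟩
      · by_cases h : i = k
        · subst h
          simp [hy]
        · simpa [h] using hr i
      · simp only [Pi.add_apply, Pi.neg_apply, Pi.smul_apply, smul_eq_mul,
          Finset.sum_add_distrib, Finset.sum_neg_distrib, ← Finset.mul_sum]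
        simp
        linarith
    exact mem_vectorSpan_of_add_smul_mem hε (by simpa using hmem 0 (by simp) (by simp))
      (hmem ε hy1 hy2)

theorem dimSet_monotoneSimplex : dimSet (monotoneSimplex n) = n := by
  have : vectorSpan ℝ (monotoneSimplex n) = ⊤ := by
    refine eq_top_iff.2 fun y _ => ?_
    obtain ⟨ε, hε, hy1, hy2⟩ := exists_small_smul y
    refine mem_vectorSpan_of_add_smul_mem (q := 0) hε ⟨by simp, by simp⟩ ⟨?_, ?_⟩
    · simpa using hy1
    · simpa [← Finset.mul_sum] using hy2
  rw [dimSet, this, finrank_top, Module.finrank_fin_fun]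

theorem hasCodim_simplex_two {j k : Fin n} (hjk : j ≠ k) :
    HasCodim (monotoneSimplex n) (maxFace (monotoneSimplex n) (-Pi.single k 1 + 1)) 2 := by
  refine ⟨isFaceOf_maxFace _ _, ⟨simplexVertex j, (mem_maxFace_simplex_codim_two hjk).2
    ⟨simplexVertex_mem j, sum_simplexVertex j, simplexVertex_of_ne hjk.symm⟩⟩, ?_⟩
  have hn : 2 ≤ n := by
    have := Finset.card_le_univ ({j, k} : Finset (Fin n))
    rwa [Finset.card_pair hjk, Fintype.card_fin] at this
  have hn' : (n : ℝ) - 1 ≠ 0 := by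
    have : (2 : ℝ) ≤ n := by exact_mod_cast hn
    linarith
  have hn0 : (0 : ℝ) ≤ 2 / ((n : ℝ) - 1) := by
    have : (2 : ℝ) ≤ n := by exact_mod_cast hn
    exact div_nonneg zero_le_two (by linarith)
  set φ := (dotZLin (1 : Fin n → ℤ)).prod (dotZLin (Pi.single k 1))
  have hspan : vectorSpan ℝ (maxFace (monotoneSimplex n) (-Pi.single k 1 + 1)) =
      LinearMap.ker φ := by
    apply le_antisymm
    · rw [vectorSpan_def, Submodule.span_le]
      rintro _ ⟨x, hx, y, hy, rfl⟩
      obtain ⟨-, hx1, hx2⟩ := (mem_maxFace_simplex_codim_two hjk).1 hx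
      obtain ⟨-, hy1, hy2⟩ := (mem_maxFace_simplex_codim_two hjk).1 hy
      simp [φ, dotZ_sub, dotZ_one, dotZ_single, hx1, hx2, hy1, hy2]
    · intro y hy
      obtain ⟨hy0, hyk⟩ : ∑ i, y i = 0 ∧ y k = 0 := by
        simpa [φ, dotZ_one, dotZ_single] using hy
      obtain ⟨ε, hε, hy1, -⟩ := exists_small_smul y
      set q : Fin n → ℝ := fun i => 2 / ((n : ℝ) - 1) - if i = k then 2 / ((n : ℝ) - 1) + 1 else 0
      have hmem : ∀ r : ℝ, (∀ i, -1 ≤ r * y i) →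
          q + r • y ∈ maxFace (monotoneSimplex n) (-Pi.single k 1 + 1) := by
        intro r hr
        have hs : ∑ i, (q + r • y) i = 1 := by
          simp only [q, Pi.add_apply, Pi.smul_apply, smul_eq_mul, Finset.sum_add_distrib,
            ← Finset.mul_sum, hy0, Finset.sum_sub_distrib]
          simp
          field_simp
          ring
        refine (mem_maxFace_simplex_codim_two hjk).2 ⟨⟨fun i => ?_, hs.le⟩, hs, by simp [q, hyk]⟩
        by_cases h : i = k
        · subst h
          simp [q, hyk]
        · have := hr i
          simp only [q, Pi.add_apply, Pi.smul_apply, smul_eq_mul, h, if_false]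
          linarith
      exact mem_vectorSpan_of_add_smul_mem hε (by simpa using hmem 0 (by simp)) (hmem ε hy1)
  have hrange : LinearMap.range φ = ⊤ := by
    refine LinearMap.range_eq_top.2 fun r =>
      ⟨r.2 • Pi.single k 1 + (r.1 - r.2) • Pi.single j 1, ?_⟩
    ext
    · simp [φ, dotZ_one, Finset.sum_add_distrib, ← Finset.mul_sum]
    · simp [φ, dotZ_single, hjk.symm]
  have := LinearMap.finrank_range_add_finrank_ker φ
  rw [hrange, finrank_top, Module.finrank_prod, Module.finrank_self, Module.finrank_fin_fun,
    ← hspan] at this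
  rw [dimSet]
  omega

theorem eq_maxFace_of_isFacetOf_simplex [NeZero n] {j k : Fin n} (hjk : j ≠ k)
    {F : Set (Fin n → ℝ)} (hF : IsFacetOf (monotoneSimplex n) F)
    (hG : maxFace (monotoneSimplex n) (-Pi.single k 1 + 1) ⊆ F) :
    F = maxFace (monotoneSimplex n) (-Pi.single k 1) ∨ F = maxFace (monotoneSimplex n) 1 := by
  obtain ⟨⟨u, hFu⟩, -, hdim⟩ := hF
  have hvF : ∀ i ≠ k, simplexVertex i ∈ F := fun i hi =>
    hG ((mem_maxFace_simplex_codim_two hi).2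
      ⟨simplexVertex_mem i, sum_simplexVertex i, simplexVertex_of_ne hi.symm⟩)
  have hmax : ∀ i ≠ k, ∀ y ∈ monotoneSimplex n, dotR u y ≤ dotR u (simplexVertex i) := by
    intro i hi
    have := hvF i hi
    rw [hFu] at this
    exact this.2
  have hval : ∀ i, dotR u (simplexVertex i) = -∑ l, u l + u i * (n + 1) := by
    intro i
    simp [dotR, simplexVertex, mul_add, Finset.sum_add_distrib]
  have hnpos : (0 : ℝ) < n + 1 := by positivity
  have hu : ∀ i ≠ k, u i = u j := by
    intro i hi
    have h1 := hmax i hi _ (simplexVertex_mem j)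
    have h2 := hmax j hjk _ (simplexVertex_mem i)
    rw [hval, hval] at h1 h2
    have : (u i - u j) * (n + 1) = 0 := by linarith
    have := (mul_eq_zero.1 this).resolve_right hnpos.ne'
    linarith
  have hform : ∀ x, dotR u x = u j * ∑ i, x i + (u k - u j) * x k := by
    intro x
    have : ∀ i, u i * x i = u j * x i + if i = k then (u k - u j) * x k else 0 := by
      intro i
      split_ifs with h
      · subst h
        ring
      · rw [hu i h, add_zero]
    simp only [dotR]
    rw [Finset.sum_congr rfl fun i _ => this i, Finset.sum_add_distrib, ← Finset.mul_sum]
    simp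
  have hj : dotR u (simplexVertex j) = 2 * u j - u k := by
    rw [hform, sum_simplexVertex, simplexVertex_of_ne hjk.symm]
    ring
  have htop : 0 ≤ u j := by
    have h := hmax j hjk (fun _ => -1) ⟨fun _ => le_rfl, by simp; linarith⟩
    rw [hj, hform] at h
    simp at h
    by_contra! hneg
    nlinarith
  have hk : u k ≤ u j := by
    have h := hmax j hjk _ (simplexVertex_mem k)
    rw [hval, hval] at h
    by_contra! hneg
    nlinarith
  have hmem : ∀ x, x ∈ F ↔ x ∈ monotoneSimplex n ∧
      u j * (1 - ∑ i, x i) + (u j - u k) * (x k + 1) = 0 := by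
    intro x
    rw [hFu]
    refine and_congr_right fun hx => ?_
    have h1 : dotR u x = 2 * u j - u k ↔
        u j * (1 - ∑ i, x i) + (u j - u k) * (x k + 1) = 0 := by
      rw [hform]
      constructor <;> intro h <;> linarith
    rw [← h1, ← hj]
    exact ⟨fun h => le_antisymm (hmax j hjk x hx) (h _ (simplexVertex_mem j)),
      fun h y hy => h ▸ hmax j hjk y hy⟩
  rcases htop.eq_or_lt with h0 | h0 <;> rcases hk.eq_or_lt with hjk' | hjk'
  · have : F = monotoneSimplex n := by
      ext x
      simp [hmem, hjk', ← h0]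
    rw [this, dimSet_monotoneSimplex] at hdim
    omega
  · left
    ext x
    rw [hmem, mem_maxFace_simplex_neg_single hjk, ← h0]
    have : u k ≠ 0 := by linarith
    simp [this, add_eq_zero_iff_eq_neg]
  · right
    ext x
    rw [hmem, mem_maxFace_simplex_one, hjk']
    refine and_congr_right fun _ => ⟨fun h => ?_, fun h => by simp [h]⟩
    have : 1 - ∑ i, x i = 0 := by simpa [h0.ne'] using h
    linarith
  · have hsub : F ⊆ maxFace (monotoneSimplex n) (-Pi.single k 1 + 1) := by
      intro x hx
      obtain ⟨hx, hxe⟩ := (hmem x).1 hx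
      have h1 := hx.1 k
      have h2 := hx.2
      refine (mem_maxFace_simplex_codim_two hjk).2 ⟨hx, ?_, ?_⟩
      · by_contra hne
        have : ∑ i, x i < 1 := lt_of_le_of_ne h2 hne
        nlinarith
      · by_contra hne
        have : -1 < x k := lt_of_le_of_ne h1 (Ne.symm hne)
        nlinarith
    have hle := Submodule.finrank_mono (vectorSpan_mono ℝ hsub)
    have hcod := (hasCodim_simplex_two hjk).2.2
    rw [dimSet] at hdim hcod
    omega

theorem isCentralNormal_simplex [NeZero n] {j k : Fin n} (hjk : j ≠ k) :
    IsCentralNormal (monotoneSimplex n) (maxFace (monotoneSimplex n) (-Pi.single k 1 + 1))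
      (-Pi.single k 1 + 1) := by
  refine ⟨2, ![maxFace (monotoneSimplex n) (-Pi.single k 1), maxFace (monotoneSimplex n) 1],
    ![-Pi.single k 1, 1], ?_, ?_, ?_, by simp⟩
  · have hne : maxFace (monotoneSimplex n) (-Pi.single k 1) ≠ maxFace (monotoneSimplex n) 1 := by
      intro h
      have hmem : simplexVertex k ∈ maxFace (monotoneSimplex n) (-Pi.single k 1) := by
        rw [h]
        exact mem_maxFace_simplex_one.2 ⟨simplexVertex_mem k, sum_simplexVertex k⟩
      have := ((mem_maxFace_simplex_neg_single hjk).1 hmem).2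
      simp [simplexVertex] at this
      have : (0 : ℝ) ≤ n := by positivity
      linarith
    intro i l hil
    fin_cases i <;> fin_cases l
    exacts [rfl, absurd hil hne, absurd hil hne.symm, rfl]
  · intro i
    fin_cases i
    · refine ⟨fun x hx => ?_, isFacetNormal_simplex_neg_single hjk⟩
      obtain ⟨hx, -, hxk⟩ := (mem_maxFace_simplex_codim_two hjk).1 hx
      exact (mem_maxFace_simplex_neg_single hjk).2 ⟨hx, hxk⟩
    · refine ⟨fun x hx => ?_, isFacetNormal_simplex_one⟩
      obtain ⟨hx, hxs, -⟩ := (mem_maxFace_simplex_codim_two hjk).1 hx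
      exact mem_maxFace_simplex_one.2 ⟨hx, hxs⟩
  · intro F hF hG
    rcases eq_maxFace_of_isFacetOf_simplex hjk hF hG with h | h
    exacts [⟨0, h⟩, ⟨1, h⟩]

end Simplex

section Coordinates

variable {n : ℕ}

/-- The linear map with coordinates `dotZ (L i)`. -/
def coordMap (L : Fin n → Fin n → ℤ) : (Fin n → ℝ) →ₗ[ℝ] (Fin n → ℝ) :=
  LinearMap.pi fun i => dotZLin (L i)

@[simp]
theorem coordMap_apply (L : Fin n → Fin n → ℤ) (x : Fin n → ℝ) (i : Fin n) :
    coordMap L x i = dotZ (L i) x := rfl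

theorem aglEquiv_coordMap_image {L D : Fin n → Fin n → ℤ}
    (h : ∀ i k, L i ⬝ᵥ D k = if i = k then 1 else 0) (P : Set (Fin n → ℝ)) :
    AGLEquiv P (coordMap L '' P) := by
  refine ⟨Matrix.of L, 0, ?_, ?_⟩
  · have : Matrix.of L * (Matrix.of D).transpose = 1 := by
      ext i k
      rw [Matrix.one_apply, ← h i k]
      rfl
    exact Matrix.isUnit_det_of_right_inverse this
  · refine Set.image_congr fun x _ => ?_
    ext i
    simp [dotZ]

theorem Convex.add_sum_smul_sub_mem {ι E : Type*} [Fintype ι] [AddCommGroup E] [Module ℝ E]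
    {s : Set E} (hs : Convex ℝ s) {p : E} (hp : p ∈ s) {q : ι → E} {c : ι → ℝ}
    (hc : ∀ i, 0 ≤ c i) (hc1 : ∑ i, c i ≤ 1) (hq : ∀ i, c i ≠ 0 → q i ∈ s) :
    p + ∑ i, c i • (q i - p) ∈ s := by
  classical
  have h := hs.sum_mem (t := Finset.univ) (w := fun o : Option ι => o.elim (1 - ∑ i, c i) c)
    (z := fun o => o.elim p fun i => if c i = 0 then p else q i) ?_ ?_ ?_
  · rw [Fintype.sum_option] at h
    simp only [Option.elim] at h
    convert h using 1
    rw [sub_smul, one_smul, Finset.sum_smul, sub_add_eq_add_sub, add_sub_assoc,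
      ← Finset.sum_sub_distrib]
    congr 1
    refine Finset.sum_congr rfl fun i _ => ?_
    split_ifs with h0
    · simp [h0]
    · rw [smul_sub]
  · rintro (_ | i) -
    exacts [sub_nonneg.2 hc1, hc i]
  · simp [Fintype.sum_option]
  · rintro (_ | i) -
    · exact hp
    · by_cases h0 : c i = 0
      · simpa [h0] using hp
      · simpa [h0] using hq i h0

theorem monotoneSimplex_subset {Q : Set (Fin n → ℝ)} (hQ : Convex ℝ Q)
    (hbase : (fun _ => -1) ∈ Q) (hvert : ∀ k, simplexVertex k ∈ Q) : monotoneSimplex n ⊆ Q := by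
  rintro y ⟨hy, hsum⟩
  have hn : (0 : ℝ) < n + 1 := by positivity
  have h := hQ.add_sum_smul_sub_mem hbase (q := simplexVertex)
    (c := fun k => (y k + 1) / (n + 1)) (fun k => div_nonneg (by linarith [hy k]) hn.le) ?_
    fun k _ => hvert k
  · convert h using 1
    ext i
    simp [simplexVertex, Finset.sum_apply, div_mul_cancel₀ _ hn.ne']
  · rw [← Finset.sum_div, div_le_one hn]
    simp [Finset.sum_add_distrib]
    linarith

theorem blowupSet_monotoneSimplex_subset {Q : Set (Fin n → ℝ)} (hQ : Convex ℝ Q) {k₀ : Fin n}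
    (hbase : (fun _ => -1) ∈ Q) (hvert : simplexVertex k₀ ∈ Q)
    (hlow : ∀ k ≠ k₀, (fun i => -1 + if i = k then (n : ℝ) else 0) ∈ Q)
    (hhigh : ∀ k ≠ k₀,
      (fun i => -1 + (if i = k then (n : ℝ) else 0) + if i = k₀ then 1 else 0) ∈ Q) :
    blowupSet (monotoneSimplex n) (-Pi.single k₀ 1 + 1) ⊆ Q := by
  rintro y ⟨⟨hy, hsum⟩, hu⟩
  rw [dotZ_neg_single_add_one] at hu
  have hn : (0 : ℝ) < n := Nat.cast_pos.2 k₀.pos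
  set c : Fin n → ℝ := fun k => if k = k₀ then 0 else (y k + 1) / n with hc
  set s : ℝ := n * ∑ k, c k with hs
  have hs' : s = ∑ i, y i - y k₀ + n - 1 := by
    rw [hs, Finset.mul_sum, ← Finset.add_sum_erase _ _ (Finset.mem_univ k₀),
      ← Finset.add_sum_erase Finset.univ y (Finset.mem_univ k₀)]
    have : ∑ x ∈ Finset.univ.erase k₀, (n : ℝ) * c x = ∑ x ∈ Finset.univ.erase k₀, (y x + 1) := by
      refine Finset.sum_congr rfl fun k hk => ?_
      rw [hc]
      simp only [Finset.ne_of_mem_erase hk, if_false]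
      field_simp
    rw [this, Finset.sum_add_distrib]
    simp [hc, Nat.cast_sub k₀.pos]
    ring
  have hc0 : ∀ k, 0 ≤ c k := fun k => by
    rw [hc]
    dsimp only
    split_ifs
    exacts [le_rfl, div_nonneg (by linarith [hy k]) hn.le]
  have hc1 : ∑ k, c k ≤ 1 := by
    have : (n : ℝ) * ∑ k, c k ≤ n * 1 := by linarith
    exact le_of_mul_le_mul_left this hn
  have hck : ∀ k, c k ≠ 0 → k ≠ k₀ := fun k hk h => hk (by simp [hc, h])
  have hbot := hQ.add_sum_smul_sub_mem hbase hc0 hc1 fun k hk => hlow k (hck k hk)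
  have htop := hQ.add_sum_smul_sub_mem hvert hc0 hc1 fun k hk => hhigh k (hck k hk)
  have hh : 0 < n + 1 - s := by linarith
  obtain ⟨θ, hθ⟩ : ∃ θ, θ * (n + 1 - s) = y k₀ + 1 := ⟨_, div_mul_cancel₀ _ hh.ne'⟩
  have hθ0 : 0 ≤ θ := nonneg_of_mul_nonneg_left (by linarith [hy k₀]) hh
  have hθ1 : θ ≤ 1 := le_of_mul_le_mul_right (by linarith) hh
  have h := hQ hbot htop (sub_nonneg.2 hθ1) hθ0 (sub_add_cancel _ _)
  convert h using 1
  ext i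
  by_cases hi : i = k₀
  · subst hi
    have : ∑ x, c x * ((if i = x then (n : ℝ) else 0) - n) = -s := by
      rw [hs, Finset.mul_sum, ← Finset.sum_neg_distrib]
      refine Finset.sum_congr rfl fun x _ => ?_
      by_cases hx : i = x
      · simp [hc, hx]
      · simp [hx, mul_comm]
    simp [simplexVertex, Finset.sum_apply, this]
    simp [hc]
    linarith
  · have : c i * n = y i + 1 := by simp [hc, hi, hn.ne']
    simp [simplexVertex, Finset.sum_apply, hi, this]
    ring

end Coordinates

/-- Bonavero / Theorem 1.2: if `n ≥ 3` and the monotone polytope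
`P ⊆ ℝ^n` admits a monotone blow-up at a vertex `v`, then `P` is
`AGL(n,ℤ)`-equivalent to the monotone simplex `Δ` or to the monotone blow-up of
`Δ` at one of its codimension-two faces. -/
theorem monotone_blowup_at_vertex {n : ℕ} (hn : 3 ≤ n) (P : Set (Fin n → ℝ))
    (hP : IsMonotonePolytope P)
    (v : Fin n → ℝ) (hv : IsVertexOf P v)
    (u : Fin n → ℤ) (hblow : AdmitsMonotoneBlowup P {v} u) :
    AGLEquiv P (monotoneSimplex n) ∨
    ∃ (G : Set (Fin n → ℝ)) (w : Fin n → ℤ),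
      HasCodim (monotoneSimplex n) G 2 ∧
      IsCentralNormal (monotoneSimplex n) G w ∧
      AGLEquiv P (blowupSet (monotoneSimplex n) w) := by
  obtain ⟨L, D, a, hC⟩ := hP.exists_isVertexChart hv
  have hrefl := hP.2.2
  have hvP := hv.mem
  have hn0 : NeZero n := ⟨by omega⟩
  have ha : ∀ k, (n : ℤ) ≤ a k := by
    intro k
    have hne : v + (a k : ℝ) • latVec (D k) ∉ ({v} : Set (Fin n → ℝ)) := by
      intro h
      have h1 := hC.dotZ_neighbor k k
      rw [Set.mem_singleton_iff.1 h, hC.base] at h1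
      have := hC.length_pos k
      simp at h1
      omega
    have h := hblow.2.1 _ (hC.neighbor k) hne
    rw [hC.centralNormal_eq hrefl hvP hblow.1, dotZ_neg_left, dotZ_sum_left] at h
    simp only [hC.dotZ_neighbor, Finset.sum_add_distrib] at h
    simp at h
    exact_mod_cast h
  choose U hU hUD hUw hUall hUmem using hC.exists_opposite_normal hP hvP
  have hcoord : ∀ j x, dotZ (U j) x = ∑ k, ((U j ⬝ᵥ D k : ℤ) : ℝ) * dotZ (L k) x := by
    intro j x
    conv_lhs => rw [eq_sum_smul_of_dual hC.dual (U j)]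
    simp only [dotZ_sum_left, dotZ_smul_left]
  have hval : ∀ j k, dotZ (U j) (v + (a k : ℝ) • latVec (D k)) =
      ((-∑ i, U j ⬝ᵥ D i + a k * (U j ⬝ᵥ D k) : ℤ) : ℝ) := by
    intro j k
    rw [hcoord]
    simp [hC.dotZ_neighbor, mul_add, Finset.sum_add_distrib, mul_comm]
  have hsum : ∀ j, ∑ k, U j ⬝ᵥ D k = a j - 1 := by
    intro j
    have h := hUw j
    rw [hval, hUD] at h
    have : -∑ i, U j ⬝ᵥ D i + a j * 1 = 1 := by exact_mod_cast h
    linarith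
  have hle1 : ∀ j k, -∑ i, U j ⬝ᵥ D i + a k * (U j ⬝ᵥ D k) ≤ 1 := by
    intro j k
    have h := hrefl.dotZ_le_one (hU j) (hC.neighbor k).mem
    rw [hval] at h
    exact_mod_cast h
  have hle : ∀ j k, a k * (U j ⬝ᵥ D k) ≤ a j := fun j k => by
    linarith [hle1 j k, hsum j]
  have hneL : ∀ j i, U j ≠ -L i := by
    intro j i h
    have h1 := hUD j
    rw [h, neg_dotProduct, hC.dual] at h1
    split_ifs at h1
    omega
  have hQ : Convex ℝ (coordMap L '' P) := hP.convex.linear_image _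
  have hbase : (fun _ => -1) ∈ coordMap L '' P := ⟨v, hvP, funext hC.base⟩
  have hvert : ∀ k, a k = n + 1 → simplexVertex k ∈ coordMap L '' P := by
    intro k hk
    refine ⟨_, (hC.neighbor k).mem, ?_⟩
    ext i
    rw [coordMap_apply, hC.dotZ_neighbor, simplexVertex, hk]
    push_cast
    rfl
  have hone : ∀ j, (∀ k, U j ⬝ᵥ D k = 1) → ∀ x ∈ P, ∑ i, coordMap L x i ≤ 1 := by
    intro j hj x hx
    have h := hrefl.dotZ_le_one (hU j) hx
    rw [hcoord] at h
    simpa [hj] using h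
  obtain ⟨j, h | ⟨k₀, hj, hjk₀, hk⟩⟩ := coefficient_dichotomy (by omega) hsum hle ha hUD
  · left
    have : coordMap L '' P = monotoneSimplex n := by
      refine subset_antisymm ?_ (monotoneSimplex_subset hQ hbase fun k => hvert k (h k).2)
      rintro _ ⟨x, hx, rfl⟩
      exact ⟨hC.lower x hx, hone j (fun k => (h k).1) x hx⟩
    exact this ▸ aglEquiv_coordMap_image hC.dual P
  · right
    have hjne : j ≠ k₀ := by
      rintro rfl
      rw [hUD] at hjk₀
      omega
    have hUeq : ∀ k ≠ k₀, U j = U k := by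
      intro k hkk
      refine (hUall k (U j) (hU j) ?_).resolve_right fun ⟨i, hi⟩ => hneL j i hi
      rw [hval, hsum, (hk k hkk).1, (hk k hkk).2, hj]
      simp
    have hlow : ∀ k ≠ k₀, (n : ℤ) * (U k₀ ⬝ᵥ D k) ≤ a k₀ - 1 := by
      intro k hkk
      by_contra! hlt
      have h1 := hle1 k₀ k
      have h2 := hsum k₀
      rw [(hk k hkk).2] at h1
      have h3 : dotZ (U k₀) (v + (a k : ℝ) • latVec (D k)) = 1 := by
        rw [hval, (hk k hkk).2]
        exact_mod_cast le_antisymm h1 (by linarith)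
      have h4 := (hUall k _ (hU k₀) h3).resolve_right fun ⟨i, hi⟩ => hneL k₀ i hi
      have h5 := hUD k₀
      rw [h4, ← hUeq k hkk, hjk₀] at h5
      omega
    obtain ⟨hak₀, hUk₀⟩ := coefficient_eq_one hn (hsum k₀) (ha k₀) (hUD k₀) hlow
    refine ⟨_, _, hasCodim_simplex_two hjne, isCentralNormal_simplex hjne, ?_⟩
    have : coordMap L '' P = blowupSet (monotoneSimplex n) (-Pi.single k₀ 1 + 1) := by
      refine subset_antisymm ?_ (blowupSet_monotoneSimplex_subset hQ hbase (hvert k₀ hak₀) ?_ ?_)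
      · rintro _ ⟨x, hx, rfl⟩
        refine ⟨⟨hC.lower x hx, hone k₀ hUk₀ x hx⟩, ?_⟩
        have h := hrefl.dotZ_le_one (hU j) hx
        rw [hcoord, ← Finset.add_sum_erase _ _ (Finset.mem_univ k₀), hjk₀,
          Finset.sum_congr rfl fun k hk' => by
            rw [(hk k (Finset.ne_of_mem_erase hk')).1, Int.cast_one, one_mul]] at h
        rw [dotZ_neg_single_add_one, ← Finset.add_sum_erase _ _ (Finset.mem_univ k₀)]
        simpa using h
      · intro k hkk
        refine ⟨_, (hC.neighbor k).mem, ?_⟩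
        ext i
        rw [coordMap_apply, hC.dotZ_neighbor, (hk k hkk).2]
        rfl
      · intro k hkk
        refine ⟨_, hUmem k k₀ hkk.symm, ?_⟩
        ext i
        rw [coordMap_apply, dotZ_add, hC.dotZ_neighbor, (hk k hkk).2, ← hUeq k hkk, hjk₀, zero_smul,
          sub_zero, hC.dotZ_direction]
        rfl
    exact this ▸ aglEquiv_coordMap_image hC.dual P
end

section
/- For every n ≥ 4 there exist two faces F_1 and F_2 of the monotone simplex Δ ⊆ ℝ^n, each of codimension strictly greater than 2, such that Δ admits disjoint monotone blow-ups at F_1 and F_2. -/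
open Finset

lemma dotZ_eq_dotR {n : ℕ} (u : Fin n → ℤ) (x : Fin n → ℝ) :
    dotZ u x = dotR (fun i => (u i : ℝ)) x := rfl

lemma dotR_add {n : ℕ} (c x y : Fin n → ℝ) : dotR c (x + y) = dotR c x + dotR c y := by
  simp [dotR, mul_add, sum_add_distrib]

lemma dotR_sub {n : ℕ} (c x y : Fin n → ℝ) : dotR c (x - y) = dotR c x - dotR c y := by
  simp [dotR, mul_sub, sum_sub_distrib]

lemma dotR_smul {n : ℕ} (c : Fin n → ℝ) (r : ℝ) (x : Fin n → ℝ) :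
    dotR c (r • x) = r * dotR c x := by
  simp [dotR, mul_sum, mul_left_comm]

lemma dotR_sum {n : ℕ} {ι : Type*} (c : Fin n → ℝ) (s : Finset ι) (x : ι → Fin n → ℝ) :
    dotR c (∑ t ∈ s, x t) = ∑ t ∈ s, dotR c (x t) := by
  simp only [dotR, Finset.sum_apply, mul_sum]
  exact sum_comm

lemma dotR_sum_left {n : ℕ} {ι : Type*} (s : Finset ι) (c : ι → Fin n → ℝ) (x : Fin n → ℝ) :
    dotR (∑ t ∈ s, c t) x = ∑ t ∈ s, dotR (c t) x := by
  simp only [dotR, Finset.sum_apply, sum_mul]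
  exact sum_comm

/-- The linear functional `dotR c`. -/
def dotLin {n : ℕ} (c : Fin n → ℝ) : (Fin n → ℝ) →ₗ[ℝ] ℝ where
  toFun := dotR c
  map_add' := dotR_add c
  map_smul' r x := by simp [dotR_smul]

lemma continuous_dotZ {n : ℕ} (u : Fin n → ℤ) : Continuous (dotZ u) := by
  unfold dotZ; fun_prop

/-- The integer vector `d` viewed in `ℝ^n`. -/
def toReal {n : ℕ} (d : Fin n → ℤ) : Fin n → ℝ := fun i => (d i : ℝ)

lemma dotR_toReal {n : ℕ} (u d : Fin n → ℤ) :
    dotR (fun i => (u i : ℝ)) (toReal d) = ((u ⬝ᵥ d : ℤ) : ℝ) := by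
  simp [dotR, toReal, dotProduct]

lemma isPrimitiveZ_of_dotProduct {n : ℕ} {u w : Fin n → ℤ} (h : u ⬝ᵥ w = -1) :
    IsPrimitiveZ u := by
  have hd : univ.gcd u ∣ -1 := by
    rw [← h]
    exact dvd_sum fun i _ => (gcd_dvd (mem_univ i)).mul_right _
  unfold IsPrimitiveZ
  rw [← Finset.normalize_gcd]
  exact normalize_eq_one.2 (isUnit_of_dvd_unit hd (by simp))

/-- A vertex `v` of a polytope `P` at which `P` looks like a unimodular cone: the facets through
`v` have normals `U s`, and the edges at `v` have directions `d s`, forming a basis dual to `-U`. -/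
structure VertexChart {n : ℕ} (P : Set (Fin n → ℝ)) (v : Fin n → ℝ)
    (U d : Fin n → Fin n → ℤ) : Prop where
  mem : v ∈ P
  le : ∀ s, ∀ x ∈ P, dotZ (U s) x ≤ 1
  eq_one : ∀ s, dotZ (U s) v = 1
  dual : ∀ s t, U s ⬝ᵥ d t = if s = t then -1 else 0
  edge : ∀ t, v + toReal (d t) ∈ P

/-- The face of `P` on which the inequalities indexed by `T` are equalities. -/
def tightFace {n : ℕ} (P : Set (Fin n → ℝ)) (U : Fin n → Fin n → ℤ) (T : Finset (Fin n)) :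
    Set (Fin n → ℝ) :=
  {x ∈ P | ∀ t ∈ T, dotZ (U t) x = 1}

namespace VertexChart

variable {n : ℕ} {P : Set (Fin n → ℝ)} {v : Fin n → ℝ} {U d : Fin n → Fin n → ℤ}

lemma dotZ_dir (h : VertexChart P v U d) (s t : Fin n) :
    dotZ (U s) (toReal (d t)) = if s = t then -1 else 0 := by
  rw [dotZ_eq_dotR, dotR_toReal, h.dual]
  split_ifs <;> simp

lemma dual_swap (h : VertexChart P v U d) :
    (Matrix.of d).transpose * Matrix.of U = -1 := by
  have h1 : Matrix.of U * (-(Matrix.of d).transpose) = 1 := by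
    ext s t
    have := h.dual s t
    rw [Matrix.mul_neg, Matrix.neg_apply, Matrix.mul_apply]
    simp only [Matrix.transpose_apply, Matrix.of_apply, Matrix.one_apply]
    rw [dotProduct] at this
    rw [this]
    split_ifs <;> simp
  have h2 := mul_eq_one_comm.1 h1
  rw [Matrix.neg_mul] at h2
  rw [← h2, neg_neg]

lemma isUnit_det (h : VertexChart P v U d) : IsUnit (Matrix.det (Matrix.of d)) := by
  have h1 : (Matrix.of d).transpose * (-Matrix.of U) = 1 := by
    rw [Matrix.mul_neg, h.dual_swap, neg_neg]
  rw [← Matrix.det_transpose]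
  exact IsUnit.of_mul_eq_one _ (by rw [← Matrix.det_mul, h1, Matrix.det_one])

lemma expand (h : VertexChart P v U d) (x : Fin n → ℝ) :
    x = ∑ t, (-dotZ (U t) x) • toReal (d t) := by
  ext i
  have h1 : ∀ j, ∑ t, (d t i : ℝ) * (U t j : ℝ) = if i = j then -1 else 0 := by
    intro j
    have := congrFun (congrFun h.dual_swap i) j
    simp only [Matrix.mul_apply, Matrix.transpose_apply, Matrix.of_apply, Matrix.neg_apply,
      Matrix.one_apply] at this
    have h2 := congrArg (Int.cast : ℤ → ℝ) this
    push_cast at h2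
    rw [h2]
    split_ifs <;> simp
  have h3 : ∑ t, -dotZ (U t) x * (d t i : ℝ) = -∑ j, (∑ t, (d t i : ℝ) * (U t j : ℝ)) * x j := by
    simp only [dotZ, sum_mul, neg_mul, sum_neg_distrib]
    rw [sum_comm]
    congr 1
    exact sum_congr rfl fun j _ => sum_congr rfl fun t _ => by ring
  simp only [Finset.sum_apply, Pi.smul_apply, smul_eq_mul, toReal]
  rw [h3]
  simp [h1]

lemma expand_dotR (h : VertexChart P v U d) (c x : Fin n → ℝ) :
    dotR c x = ∑ t, (-dotR c (toReal (d t))) * dotZ (U t) x := by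
  conv_lhs => rw [h.expand x]
  rw [dotR_sum]
  exact sum_congr rfl fun t _ => by rw [dotR_smul]; ring

lemma linearIndependent (h : VertexChart P v U d) :
    LinearIndependent ℝ (fun t => toReal (d t)) := by
  rw [Fintype.linearIndependent_iff]
  intro g hg s
  have h1 := congrArg (dotR fun i => (U s i : ℝ)) hg
  rw [dotR_sum] at h1
  simp only [dotR_smul, ← dotZ_eq_dotR, h.dotZ_dir] at h1
  simpa [dotZ] using h1

lemma mem_tightFace (h : VertexChart P v U d) (T : Finset (Fin n)) : v ∈ tightFace P U T :=
  ⟨h.mem, fun t _ => h.eq_one t⟩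

lemma dotZ_edge (h : VertexChart P v U d) (s t : Fin n) :
    dotZ (U s) (v + toReal (d t)) = if s = t then 0 else 1 := by
  rw [dotZ_eq_dotR, dotR_add, ← dotZ_eq_dotR, ← dotZ_eq_dotR, h.eq_one, h.dotZ_dir]
  split_ifs <;> simp

lemma edge_mem_tightFace (h : VertexChart P v U d) {T : Finset (Fin n)} {t : Fin n} :
    v + toReal (d t) ∈ tightFace P U T ↔ t ∉ T := by
  constructor
  · intro hm ht
    have := hm.2 t ht
    simp [h.dotZ_edge] at this
  · refine fun ht => ⟨h.edge t, fun s hs => ?_⟩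
    rw [h.dotZ_edge, if_neg]
    rintro rfl
    exact ht hs

lemma subset_of_tightFace_subset (h : VertexChart P v U d) {S T : Finset (Fin n)}
    (hST : tightFace P U S ⊆ tightFace P U T) : T ⊆ S := by
  intro t ht
  by_contra hs
  exact h.edge_mem_tightFace.1 (hST (h.edge_mem_tightFace.2 hs)) ht

lemma tightFace_injective (h : VertexChart P v U d) : Function.Injective (tightFace P U) :=
  fun _ _ hST => (h.subset_of_tightFace_subset hST.ge).antisymm
    (h.subset_of_tightFace_subset hST.le)

lemma dimSet_tightFace (h : VertexChart P v U d) (T : Finset (Fin n)) :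
    dimSet (tightFace P U T) + T.card = n := by
  have h1 : vectorSpan ℝ (tightFace P U T) =
      Submodule.span ℝ (Set.range fun t : {t // t ∉ T} => toReal (d t)) := by
    apply le_antisymm
    · rw [vectorSpan_def, Submodule.span_le]
      rintro _ ⟨x, hx, y, hy, rfl⟩
      simp only [vsub_eq_sub, SetLike.mem_coe]
      rw [h.expand (x - y)]
      refine Submodule.sum_mem _ fun t _ => ?_
      by_cases ht : t ∈ T
      · rw [dotZ_eq_dotR, dotR_sub, ← dotZ_eq_dotR, ← dotZ_eq_dotR, hx.2 t ht, hy.2 t ht]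
        simp
      · exact Submodule.smul_mem _ _ (Submodule.subset_span ⟨⟨t, ht⟩, rfl⟩)
    · rw [Submodule.span_le]
      rintro _ ⟨⟨t, ht⟩, rfl⟩
      have := vsub_mem_vectorSpan ℝ (h.edge_mem_tightFace.2 ht) (h.mem_tightFace T)
      simpa using this
  have h2 := finrank_span_eq_card
    (h.linearIndependent.comp (Subtype.val : {t // t ∉ T} → Fin n) Subtype.val_injective)
  have h3 := Finset.card_le_univ T
  rw [dimSet, h1]
  simp only [Function.comp_def] at h2
  rw [h2, Fintype.card_subtype_compl]
  simp at h3 ⊢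
  omega

/-- The faces through `v` are the tight faces. -/
lemma eq_tightFace (h : VertexChart P v U d) {c : Fin n → ℝ}
    (hv : ∀ y ∈ P, dotR c y ≤ dotR c v) :
    (∀ t, 0 ≤ -dotR c (toReal (d t))) ∧
    {x ∈ P | ∀ y ∈ P, dotR c y ≤ dotR c x} =
      tightFace P U {t | -dotR c (toReal (d t)) ≠ 0} := by
  have h0 : ∀ t, 0 ≤ -dotR c (toReal (d t)) := by
    intro t
    have := hv _ (h.edge t)
    rw [dotR_add] at this
    linarith
  have key : ∀ x, dotR c v - dotR c x =
      ∑ t, (-dotR c (toReal (d t))) * (1 - dotZ (U t) x) := by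
    intro x
    rw [h.expand_dotR c v, h.expand_dotR c x, ← sum_sub_distrib]
    exact sum_congr rfl fun t _ => by rw [h.eq_one]; ring
  refine ⟨h0, ?_⟩
  ext x
  constructor
  · rintro ⟨hx, hmax⟩
    refine ⟨hx, fun t ht => ?_⟩
    have h1 : dotR c v - dotR c x ≤ 0 := by linarith [hmax v h.mem]
    rw [key] at h1
    have hnn : ∀ t ∈ univ, 0 ≤ (-dotR c (toReal (d t))) * (1 - dotZ (U t) x) :=
      fun t _ => mul_nonneg (h0 t) (by linarith [h.le t x hx])
    have h2 := (sum_eq_zero_iff_of_nonneg hnn).1 (le_antisymm h1 (sum_nonneg hnn)) t (mem_univ t)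
    have ht' := (mem_filter.1 ht).2
    have := (mul_eq_zero.1 h2).resolve_left ht'
    linarith
  · rintro ⟨hx, ht⟩
    refine ⟨hx, fun y hy => (hv y hy).trans ?_⟩
    have h1 : dotR c v - dotR c x = 0 := by
      rw [key]
      refine sum_eq_zero fun t _ => ?_
      by_cases hc : -dotR c (toReal (d t)) = 0
      · rw [hc, zero_mul]
      · rw [ht t (by simpa using hc)]; simp
    linarith

lemma exists_eq_tightFace (h : VertexChart P v U d) {F : Set (Fin n → ℝ)} (hF : IsFaceOf P F)
    (hv : v ∈ F) : ∃ T, F = tightFace P U T := by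
  obtain ⟨c, rfl⟩ := hF
  exact ⟨_, (h.eq_tightFace hv.2).2⟩

lemma tightFace_eq (h : VertexChart P v U d) (T : Finset (Fin n)) :
    tightFace P U T = {x ∈ P | ∀ y ∈ P, dotR (∑ t ∈ T, toReal (U t)) y ≤
      dotR (∑ t ∈ T, toReal (U t)) x} := by
  have hv : ∀ y ∈ P, dotR (∑ t ∈ T, toReal (U t)) y ≤ dotR (∑ t ∈ T, toReal (U t)) v := by
    intro y hy
    rw [dotR_sum_left, dotR_sum_left]
    exact sum_le_sum fun t _ => (h.le t y hy).trans (h.eq_one t).ge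
  rw [(h.eq_tightFace hv).2]
  congr 1
  ext t
  have : dotR (∑ t ∈ T, toReal (U t)) (toReal (d t)) = if t ∈ T then -1 else 0 := by
    rw [dotR_sum_left]
    have h1 : ∀ s, dotR (toReal (U s)) (toReal (d t)) = if s = t then -1 else 0 :=
      fun s => h.dotZ_dir s t
    simp [h1]
  simp [this]

lemma isFaceOf_tightFace (h : VertexChart P v U d) (T : Finset (Fin n)) :
    IsFaceOf P (tightFace P U T) := ⟨_, h.tightFace_eq T⟩

lemma isFacetOf_tightFace (h : VertexChart P v U d) (s : Fin n) :
    IsFacetOf P (tightFace P U {s}) :=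
  ⟨h.isFaceOf_tightFace _, ⟨v, h.mem_tightFace _⟩, by simpa using h.dimSet_tightFace {s}⟩

lemma exists_eq_of_isFacetOf (h : VertexChart P v U d) {F : Set (Fin n → ℝ)}
    (hF : IsFacetOf P F) (hv : v ∈ F) : ∃ s, F = tightFace P U {s} := by
  obtain ⟨T, rfl⟩ := h.exists_eq_tightFace hF.1 hv
  have h1 := h.dimSet_tightFace T
  have h2 := hF.2.2
  obtain ⟨s, rfl⟩ := card_eq_one.1 (show T.card = 1 by omega)
  exact ⟨s, rfl⟩

lemma isPrimitiveZ_normal (h : VertexChart P v U d) (s : Fin n) : IsPrimitiveZ (U s) :=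
  isPrimitiveZ_of_dotProduct (w := d s) (by simp [h.dual])

lemma isPrimitiveZ_dir (h : VertexChart P v U d) (s : Fin n) : IsPrimitiveZ (d s) :=
  isPrimitiveZ_of_dotProduct (w := U s) (by rw [dotProduct_comm]; simp [h.dual])

lemma isFacetNormal_tightFace (h : VertexChart P v U d) (s : Fin n) :
    IsFacetNormal P (tightFace P U {s}) (U s) :=
  ⟨h.isPrimitiveZ_normal s, h.isFacetOf_tightFace s, by
    conv_lhs => rw [h.tightFace_eq {s}]
    simp only [sum_singleton]
    rfl⟩

lemma dotZ_eq_one_of_isFacetNormal (h : VertexChart P v U d) {F : Set (Fin n → ℝ)}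
    {u : Fin n → ℤ} (hF : IsFacetNormal P F u) (hv : v ∈ F) : ∀ x ∈ F, dotZ u x = 1 := by
  obtain ⟨hu, hfacet, hFeq⟩ := hF
  obtain ⟨s, hs⟩ := h.exists_eq_of_isFacetOf hfacet hv
  have hmax : ∀ y ∈ P, dotR (toReal u) y ≤ dotR (toReal u) v := by
    rw [hFeq] at hv
    exact hv.2
  obtain ⟨h0, h1⟩ := h.eq_tightFace hmax
  have h2 : ({s} : Finset (Fin n)) = univ.filter fun t => -dotR (toReal u) (toReal (d t)) ≠ 0 :=
    h.tightFace_injective (hs.symm.trans (hFeq.trans h1))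
  have h3 : ∀ t, t ≠ s → dotR (toReal u) (toReal (d t)) = 0 := by
    intro t ht
    by_contra hne
    have : t ∈ ({s} : Finset (Fin n)) := by rw [h2]; simpa using hne
    exact ht (mem_singleton.1 this)
  have h4 : ∀ x, dotR (toReal u) x = -dotR (toReal u) (toReal (d s)) * dotZ (U s) x := by
    intro x
    rw [h.expand_dotR, sum_eq_single s]
    · intro t _ ht; rw [h3 t ht]; simp
    · simp
  have h5 : dotR (toReal u) (toReal (d s)) = ((u ⬝ᵥ d s : ℤ) : ℝ) := dotR_toReal u (d s)
  have h6 : ∀ i, u i = -(u ⬝ᵥ d s) * U s i := by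
    intro i
    have := h4 (Pi.single i 1)
    rw [h5] at this
    have e1 : dotR (toReal u) (Pi.single i 1) = u i := by simp [dotR, toReal, Pi.single_apply]
    have e2 : dotZ (U s) (Pi.single i 1) = U s i := by simp [dotZ, Pi.single_apply]
    rw [e1, e2] at this
    exact_mod_cast this
  have h7 : -(u ⬝ᵥ d s) ∣ univ.gcd u := dvd_gcd fun i _ => ⟨_, h6 i⟩
  rw [hu] at h7
  have h8 : 0 ≤ -(u ⬝ᵥ d s) := by
    have := h0 s
    rw [h5] at this
    exact_mod_cast this
  have h9 : -(u ⬝ᵥ d s) = 1 := Int.eq_one_of_dvd_one h8 h7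
  intro x hx
  rw [hs] at hx
  have h10 := h4 x
  rw [h5, hx.2 s (mem_singleton_self s)] at h10
  have h11 : -((u ⬝ᵥ d s : ℤ) : ℝ) = 1 := by exact_mod_cast h9
  rw [h11, one_mul] at h10
  exact h10

lemma eq_add_smul_of_mem (h : VertexChart P v U d) {s : Fin n} {x : Fin n → ℝ}
    (hx : x ∈ tightFace P U {s}ᶜ) : x = v + (1 - dotZ (U s) x) • toReal (d s) := by
  have h1 : x - v = (1 - dotZ (U s) x) • toReal (d s) := by
    conv_lhs => rw [h.expand (x - v)]
    have h2 : ∀ t, -dotZ (U t) (x - v) = 1 - dotZ (U t) x := by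
      intro t
      rw [dotZ_eq_dotR, dotR_sub, ← dotZ_eq_dotR, ← dotZ_eq_dotR, h.eq_one]
      ring
    simp only [h2]
    rw [sum_eq_single s]
    · intro t _ ht
      rw [hx.2 t (by simpa using ht)]
      simp
    · simp
  rw [← h1]
  abel

lemma isEdgeOf_tightFace (h : VertexChart P v U d) (hP : IsCompact P) (hconv : Convex ℝ P)
    (s : Fin n) : IsEdgeOf P (tightFace P U {s}ᶜ) := by
  refine ⟨h.isFaceOf_tightFace _, ?_⟩
  have hcomp : IsCompact (tightFace P U {s}ᶜ) := by
    apply hP.inter_right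
    have : {x | ∀ t ∈ ({s} : Finset (Fin n))ᶜ, dotZ (U t) x = 1} =
        ⋂ t ∈ ({s} : Finset (Fin n))ᶜ, {x | dotZ (U t) x = 1} := by
      ext x; simp
    change IsClosed {x | ∀ t ∈ ({s} : Finset (Fin n))ᶜ, dotZ (U t) x = 1}
    rw [this]
    exact isClosed_biInter fun t _ => isClosed_eq (continuous_dotZ _) continuous_const
  obtain ⟨w, hw, hmin⟩ := hcomp.exists_isMinOn ⟨v, h.mem_tightFace _⟩
    (continuous_dotZ (U s)).continuousOn
  have hw0 : dotZ (U s) w ≤ 0 := by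
    have := hmin (h.edge_mem_tightFace (T := {s}ᶜ) (t := s) |>.2 (by simp))
    simpa [h.dotZ_edge] using this
  have hwv := h.eq_add_smul_of_mem hw
  refine ⟨v, w, ?_, ?_⟩
  · intro hvw
    rw [← hvw, h.eq_one] at hw0
    linarith
  · ext x
    rw [segment_eq_image']
    constructor
    · intro hx
      have h1 : dotZ (U s) w ≤ dotZ (U s) x := hmin hx
      have h2 := h.le s x hx.1
      refine ⟨(1 - dotZ (U s) x) / (1 - dotZ (U s) w), ⟨div_nonneg (by linarith) (by linarith),
        (div_le_one (by linarith)).2 (by linarith)⟩, ?_⟩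
      have h3 : w - v = (1 - dotZ (U s) w) • toReal (d s) := by
        conv_lhs => rw [hwv]
        abel
      change v + _ • (w - v) = x
      rw [h3, smul_smul, div_mul_cancel₀ _ (by linarith)]
      exact (h.eq_add_smul_of_mem hx).symm
    · rintro ⟨r, ⟨hr0, hr1⟩, rfl⟩
      refine ⟨?_, fun t ht => ?_⟩
      · exact hconv.segment_subset h.mem hw.1 (by
          rw [segment_eq_image']; exact ⟨r, ⟨hr0, hr1⟩, rfl⟩)
      · change dotZ _ (v + r • (w - v)) = 1
        rw [dotZ_eq_dotR, dotR_add, dotR_smul, dotR_sub, ← dotZ_eq_dotR, ← dotZ_eq_dotR,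
          h.eq_one, hw.2 t ht]
        ring

lemma exists_eq_of_isEdgeOf (h : VertexChart P v U d) {E : Set (Fin n → ℝ)}
    (hE : IsEdgeOf P E) (hv : v ∈ E) : ∃ s, E = tightFace P U {s}ᶜ := by
  obtain ⟨hface, a, b, hab, hseg⟩ := hE
  obtain ⟨T, hT⟩ := h.exists_eq_tightFace hface hv
  have h1 := h.dimSet_tightFace T
  have h2 : dimSet E = 1 := by
    rw [hseg, dimSet, vectorSpan_segment]
    exact finrank_span_singleton (sub_ne_zero.2 (by first | exact hab | exact hab.symm))
  rw [← hT, h2] at h1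
  obtain ⟨s, hs⟩ := card_eq_one.1 (show Tᶜ.card = 1 by rw [card_compl, Fintype.card_fin]; omega)
  exact ⟨s, by rw [hT, ← hs, compl_compl]⟩

end VertexChart

lemma exists_mem_of_isFaceOf_convexHull {n : ℕ} {V : Set (Fin n → ℝ)} {F : Set (Fin n → ℝ)}
    (hF : IsFaceOf (convexHull ℝ V) F) (hne : F.Nonempty) : ∃ v ∈ V, v ∈ F := by
  obtain ⟨c, rfl⟩ := hF
  obtain ⟨x, hx, hmax⟩ := hne
  obtain ⟨v, hv, hxv⟩ := ((dotLin c).convexOn convex_univ).exists_ge_of_mem_convexHull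
    (Set.subset_univ V) hx
  exact ⟨v, hv, subset_convexHull ℝ V hv, fun y hy => (hmax y hy).trans hxv⟩

lemma mem_of_isVertexOf_convexHull {n : ℕ} {V : Set (Fin n → ℝ)} {v : Fin n → ℝ}
    (hv : IsVertexOf (convexHull ℝ V) v) : v ∈ V := by
  obtain ⟨w, hw, hwv⟩ := exists_mem_of_isFaceOf_convexHull hv ⟨v, rfl⟩
  rwa [← Set.mem_singleton_iff.1 hwv]

/-- A polytope with a unimodular chart at each of its lattice vertices is monotone. -/
theorem isMonotonePolytope_of_charts {n : ℕ} {P : Set (Fin n → ℝ)} (V : Finset (Fin n → ℝ))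
    (hlat : ∀ v ∈ V, IsLatticePt v) (hP : P = convexHull ℝ (V : Set (Fin n → ℝ)))
    (h0 : (0 : Fin n → ℝ) ∈ interior P) (hch : ∀ v ∈ V, ∃ U d, VertexChart P v U d) :
    IsMonotonePolytope P := by
  have hcomp : IsCompact P := hP ▸ V.finite_toSet.isCompact_convexHull ℝ
  have hconv : Convex ℝ P := hP ▸ convex_convexHull ℝ _
  refine ⟨⟨V, hlat, hP, hconv.interior_nonempty_iff_affineSpan_eq_top.1 ⟨0, h0⟩⟩, ?_, h0, ?_⟩
  · intro v hv
    obtain ⟨U, d, h⟩ := hch v (by exact_mod_cast mem_of_isVertexOf_convexHull (hP ▸ hv))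
    refine ⟨⟨fun s => tightFace P U {s}, ?_, fun s => ⟨h.isFacetOf_tightFace s, h.mem_tightFace _⟩,
      fun F hF hvF => h.exists_eq_of_isFacetOf hF hvF⟩,
      ⟨fun s => tightFace P U {s}ᶜ, d, ?_, fun s => ⟨h.isEdgeOf_tightFace hcomp hconv s,
        h.mem_tightFace _, h.isPrimitiveZ_dir s, v + toReal (d s),
        h.edge_mem_tightFace.2 (by simp), 1, one_pos, fun i => by simp [toReal]⟩,
        fun E hE hvE => h.exists_eq_of_isEdgeOf hE hvE, h.isUnit_det⟩⟩
    · exact fun s t hst => singleton_injective (h.tightFace_injective hst)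
    · exact fun s t hst => singleton_injective (compl_injective (h.tightFace_injective hst))
  · intro F u hF
    obtain ⟨v, hv, hvF⟩ := exists_mem_of_isFaceOf_convexHull (hP ▸ hF.2.1.1) hF.2.1.2.1
    obtain ⟨U, d, h⟩ := hch v hv
    exact h.dotZ_eq_one_of_isFacetNormal hF hvF

/-- The outer facet normals of the monotone simplex: `(1, …, 1)` and the `-e i`. -/
def simplexNormal {n : ℕ} (o : Fin (n + 1)) : Fin n → ℤ :=
  Fin.cases (motive := fun _ => Fin n → ℤ) 1 (fun i => -Pi.single i 1) o

/-- The slack of `x` in the facet inequality with index `o` of the monotone simplex. -/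
def slack {n : ℕ} (x : Fin n → ℝ) (o : Fin (n + 1)) : ℝ := 1 - dotZ (simplexNormal o) x

/-- The point with slacks `y`, where `∑ o, y o = n + 1`. -/
def ofSlack {n : ℕ} (y : Fin (n + 1) → ℝ) : Fin n → ℝ := fun i => y i.succ - 1

/-- The direction along which the slacks change by `z`, where `∑ o, z o = 0`. -/
def ofSlackDir {n : ℕ} (z : Fin (n + 1) → ℤ) : Fin n → ℤ := fun i => z i.succ

/-- The sum of the facet normals of the monotone simplex with index in `I`. -/
def blowupNormal {n : ℕ} (I : Finset (Fin (n + 1))) : Fin n → ℤ := ∑ o ∈ I, simplexNormal o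

lemma slack_zero {n : ℕ} (x : Fin n → ℝ) : slack x 0 = 1 - ∑ i, x i := by
  simp [slack, simplexNormal, dotZ]

lemma slack_succ {n : ℕ} (x : Fin n → ℝ) (i : Fin n) : slack x i.succ = 1 + x i := by
  simp [slack, simplexNormal, dotZ, Pi.single_apply]

lemma sum_slack {n : ℕ} (x : Fin n → ℝ) : ∑ o, slack x o = n + 1 := by
  rw [Fin.sum_univ_succ, slack_zero]
  simp only [slack_succ, sum_add_distrib]
  simp
  ring

lemma slack_ofSlack {n : ℕ} {y : Fin (n + 1) → ℝ} (hy : ∑ o, y o = n + 1) :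
    slack (ofSlack y) = y := by
  ext o
  refine Fin.cases ?_ (fun i => ?_) o
  · rw [Fin.sum_univ_succ] at hy
    rw [slack_zero]
    simp only [ofSlack, sum_sub_distrib]
    simp
    linarith
  · rw [slack_succ, ofSlack]
    ring

lemma ofSlack_slack {n : ℕ} (x : Fin n → ℝ) : ofSlack (slack x) = x := by
  ext i
  rw [ofSlack, slack_succ]
  ring

lemma simplexNormal_dotProduct {n : ℕ} {z : Fin (n + 1) → ℤ} (hz : ∑ o, z o = 0)
    (o : Fin (n + 1)) : simplexNormal o ⬝ᵥ ofSlackDir z = -z o := by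
  refine Fin.cases ?_ (fun i => ?_) o
  · rw [Fin.sum_univ_succ] at hz
    simp [simplexNormal, ofSlackDir, dotProduct]
    linarith
  · simp [simplexNormal, ofSlackDir]

lemma blowupNormal_dotProduct {n : ℕ} {z : Fin (n + 1) → ℤ} (hz : ∑ o, z o = 0)
    (I : Finset (Fin (n + 1))) : blowupNormal I ⬝ᵥ ofSlackDir z = -∑ o ∈ I, z o := by
  rw [blowupNormal, sum_dotProduct, ← sum_neg_distrib]
  exact sum_congr rfl fun o _ => simplexNormal_dotProduct hz o

lemma dotZ_blowupNormal {n : ℕ} (I : Finset (Fin (n + 1))) (x : Fin n → ℝ) :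
    dotZ (blowupNormal I) x = I.card - ∑ o ∈ I, slack x o := by
  have h1 : dotZ (blowupNormal I) x = ∑ o ∈ I, dotZ (simplexNormal o) x := by
    simp only [dotZ_eq_dotR]
    rw [← dotR_sum_left]
    congr 1
    ext i
    simp [blowupNormal]
  simp [h1, slack]

lemma ofSlack_add_dir {n : ℕ} (y : Fin (n + 1) → ℝ) (z : Fin (n + 1) → ℤ) :
    ofSlack y + toReal (ofSlackDir z) = ofSlack (y + toReal z) := by
  ext i
  simp [ofSlack, ofSlackDir, toReal]
  ring

lemma isLatticePt_ofSlack {n : ℕ} (y : Fin (n + 1) → ℤ) :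
    IsLatticePt (ofSlack fun o => (y o : ℝ)) := fun i => ⟨y i.succ - 1, by simp [ofSlack]⟩

lemma ofSlack_sum_mem {n : ℕ} {ι : Type*} {C : Set (Fin n → ℝ)} (hC : Convex ℝ C)
    {s : Finset ι} {w : ι → ℝ} {y : ι → Fin (n + 1) → ℝ} (h0 : ∀ a ∈ s, 0 ≤ w a)
    (h1 : ∑ a ∈ s, w a = 1) (hy : ∀ a ∈ s, ofSlack (y a) ∈ C) :
    ofSlack (∑ a ∈ s, w a • y a) ∈ C := by
  have : ofSlack (∑ a ∈ s, w a • y a) = ∑ a ∈ s, w a • ofSlack (y a) := by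
    ext i
    simp [ofSlack, mul_sub, h1]
  rw [this]
  exact hC.sum_mem h0 h1 hy

lemma mem_monotoneSimplex {n : ℕ} {x : Fin n → ℝ} :
    x ∈ monotoneSimplex n ↔ ∀ o, 0 ≤ slack x o := by
  rw [Fin.forall_fin_succ, slack_zero]
  simp only [slack_succ]
  constructor
  · rintro ⟨h1, h2⟩
    exact ⟨by linarith, fun i => by linarith [h1 i]⟩
  · rintro ⟨h1, h2⟩
    exact ⟨fun i => by linarith [h2 i], by linarith⟩

lemma mem_blowupSet {n : ℕ} {I : Finset (Fin (n + 1))} {x : Fin n → ℝ} :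
    x ∈ blowupSet (monotoneSimplex n) (blowupNormal I) ↔
      (∀ o, 0 ≤ slack x o) ∧ (I.card : ℝ) - 1 ≤ ∑ o ∈ I, slack x o := by
  rw [blowupSet, Set.mem_ofPred_eq, mem_monotoneSimplex, dotZ_blowupNormal, sub_le_comm]

lemma convex_setOf_dotZ_le {n : ℕ} (u : Fin n → ℤ) : Convex ℝ {x | dotZ u x ≤ 1} :=
  convex_halfSpace_le (dotLin (toReal u)).isLinear 1

lemma monotoneSimplex_eq (n : ℕ) :
    monotoneSimplex n = ⋂ o, {x | dotZ (simplexNormal o) x ≤ 1} := by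
  ext x
  simp [mem_monotoneSimplex, slack]

lemma convex_monotoneSimplex (n : ℕ) : Convex ℝ (monotoneSimplex n) := by
  rw [monotoneSimplex_eq]
  exact convex_iInter fun o => convex_setOf_dotZ_le _

lemma convex_blowupSet {n : ℕ} (I : Finset (Fin (n + 1))) :
    Convex ℝ (blowupSet (monotoneSimplex n) (blowupNormal I)) :=
  (convex_monotoneSimplex n).inter (convex_setOf_dotZ_le _)

lemma zero_mem_interior_blowupSet {n : ℕ} (u : Fin n → ℤ) :
    (0 : Fin n → ℝ) ∈ interior (blowupSet (monotoneSimplex n) u) := by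
  have ho : ∀ w : Fin n → ℤ, IsOpen {x | dotZ w x < 1} := fun w =>
    isOpen_lt (continuous_dotZ w) continuous_const
  have hopen : IsOpen ((⋂ o : Fin (n + 1), {x | dotZ (simplexNormal o) x < 1}) ∩
      {x | dotZ u x < 1}) := (isOpen_iInter_of_finite fun o => ho _).inter (ho u)
  refine interior_maximal ?_ hopen (by simp [dotZ])
  rintro x ⟨h1, h2⟩
  refine ⟨?_, le_of_lt h2⟩
  rw [monotoneSimplex_eq]
  exact Set.mem_iInter.2 fun o => (Set.mem_iInter.1 h1 o).le (a := dotZ (simplexNormal o) x)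

/-- The slacks of the vertex of the monotone simplex opposite to the facet `a`. -/
def vertexSlack {n : ℕ} (a : Fin (n + 1)) : Fin (n + 1) → ℝ := Pi.single a ((n : ℝ) + 1)

/-- The slacks of the vertex of the blow-up at `I` on the edge joining the vertices
opposite to `a ∈ I` and `b ∉ I`. -/
def cutSlack {n : ℕ} (I : Finset (Fin (n + 1))) (a b : Fin (n + 1)) : Fin (n + 1) → ℝ :=
  Pi.single a ((I.card : ℝ) - 1) + Pi.single b ((n : ℝ) + 2 - I.card)

lemma sum_vertexSlack {n : ℕ} (a : Fin (n + 1)) : ∑ o, vertexSlack a o = n + 1 := by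
  simp [vertexSlack]

lemma sum_cutSlack {n : ℕ} (I : Finset (Fin (n + 1))) (a b : Fin (n + 1)) :
    ∑ o, cutSlack I a b o = n + 1 := by
  simp [cutSlack, sum_add_distrib]
  ring

lemma dotZ_simplexNormal_ofSlack {n : ℕ} {y : Fin (n + 1) → ℝ} (hy : ∑ o, y o = n + 1)
    (o : Fin (n + 1)) : dotZ (simplexNormal o) (ofSlack y) = 1 - y o := by
  have h1 := congrFun (slack_ofSlack hy) o
  rw [slack] at h1
  linarith

lemma vertexChart_vertexSlack {n : ℕ} {P : Set (Fin n → ℝ)} (hP : P ⊆ monotoneSimplex n)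
    (a : Fin (n + 1)) (hv : ofSlack (vertexSlack a) ∈ P)
    (he : ∀ o, o ≠ a →
      ofSlack (vertexSlack a + toReal (Pi.single o 1 - Pi.single a 1)) ∈ P) :
    VertexChart P (ofSlack (vertexSlack a)) (fun s => simplexNormal (a.succAbove s))
      (fun s => ofSlackDir (Pi.single (a.succAbove s) 1 - Pi.single a 1)) where
  mem := hv
  le s x hx := by
    have := mem_monotoneSimplex.1 (hP hx) (a.succAbove s)
    rw [slack] at this
    linarith
  eq_one s := by
    rw [dotZ_simplexNormal_ofSlack (sum_vertexSlack a)]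
    simp [vertexSlack, Fin.succAbove_ne]
  dual s t := by
    rw [simplexNormal_dotProduct (by simp)]
    simp [Pi.single_apply, Fin.succAbove_ne, apply_ite]
  edge t := by
    rw [ofSlack_add_dir]
    exact he _ (Fin.succAbove_ne a t)

lemma ofSlack_mem_monotoneSimplex {n : ℕ} {y : Fin (n + 1) → ℝ} (hy : ∑ o, y o = n + 1)
    (h0 : ∀ o, 0 ≤ y o) : ofSlack y ∈ monotoneSimplex n := by
  rw [mem_monotoneSimplex, slack_ofSlack hy]
  exact h0

lemma ofSlack_mem_blowupSet {n : ℕ} {I : Finset (Fin (n + 1))} {y : Fin (n + 1) → ℝ}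
    (hy : ∑ o, y o = n + 1) (h0 : ∀ o, 0 ≤ y o) (hI : (I.card : ℝ) - 1 ≤ ∑ o ∈ I, y o) :
    ofSlack y ∈ blowupSet (monotoneSimplex n) (blowupNormal I) := by
  rw [mem_blowupSet, slack_ofSlack hy]
  exact ⟨h0, hI⟩

lemma vertexSlack_nonneg {n : ℕ} (a o : Fin (n + 1)) : 0 ≤ vertexSlack a o := by
  rw [vertexSlack, Pi.single_apply]
  split_ifs <;> positivity

lemma sum_vertexSlack_add_edge {n : ℕ} (a o : Fin (n + 1)) :
    ∑ p, (vertexSlack a + toReal (Pi.single o 1 - Pi.single a 1) : Fin (n + 1) → ℝ) p = n + 1 := by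
  have h1 : ∑ p, ((Pi.single o 1 : Fin (n + 1) → ℤ) p : ℝ) = 1 := by
    rw [← Int.cast_sum]; simp
  have h2 : ∑ p, ((Pi.single a 1 : Fin (n + 1) → ℤ) p : ℝ) = 1 := by
    rw [← Int.cast_sum]; simp
  simp [toReal, sum_add_distrib, sum_vertexSlack, h1, h2]

lemma vertexSlack_add_edge_nonneg {n : ℕ} {a o : Fin (n + 1)} (p : Fin (n + 1)) :
    0 ≤ (vertexSlack a + toReal (Pi.single o 1 - Pi.single a 1) : Fin (n + 1) → ℝ) p := by
  have hn : (0 : ℝ) ≤ n := n.cast_nonneg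
  simp only [vertexSlack, toReal, Pi.add_apply, Pi.sub_apply, Pi.single_apply]
  split_ifs <;> simp
  linarith

lemma vertexChart_monotoneSimplex {n : ℕ} (a : Fin (n + 1)) :
    VertexChart (monotoneSimplex n) (ofSlack (vertexSlack a))
      (fun s => simplexNormal (a.succAbove s))
      (fun s => ofSlackDir (Pi.single (a.succAbove s) 1 - Pi.single a 1)) :=
  vertexChart_vertexSlack subset_rfl a
    (ofSlack_mem_monotoneSimplex (sum_vertexSlack a) (vertexSlack_nonneg a))
    fun o _ => ofSlack_mem_monotoneSimplex (sum_vertexSlack_add_edge a o)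
      vertexSlack_add_edge_nonneg

lemma vertexChart_blowupSet_of_mem {n : ℕ} {I : Finset (Fin (n + 1))} (hIn : I.card ≤ n)
    {a : Fin (n + 1)} (ha : a ∈ I) :
    VertexChart (blowupSet (monotoneSimplex n) (blowupNormal I)) (ofSlack (vertexSlack a))
      (fun s => simplexNormal (a.succAbove s))
      (fun s => ofSlackDir (Pi.single (a.succAbove s) 1 - Pi.single a 1)) := by
  have hIn' : (I.card : ℝ) ≤ n := by exact_mod_cast hIn
  refine vertexChart_vertexSlack (fun x hx => hx.1) a
    (ofSlack_mem_blowupSet (sum_vertexSlack a) (vertexSlack_nonneg a) ?_)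
    fun o ho => ofSlack_mem_blowupSet (sum_vertexSlack_add_edge a o)
      vertexSlack_add_edge_nonneg ?_
  · simp only [vertexSlack, sum_pi_single', if_pos ha]
    linarith
  · have h1 : vertexSlack a a + toReal (Pi.single o 1 - Pi.single a 1) a ≤
        ∑ p ∈ I, (vertexSlack a + toReal (Pi.single o 1 - Pi.single a 1) : Fin (n + 1) → ℝ) p :=
      single_le_sum (f := fun p => (vertexSlack a + toReal (Pi.single o 1 - Pi.single a 1) : Fin (n + 1) → ℝ) p)
        (fun p _ => vertexSlack_add_edge_nonneg p) ha
    refine le_trans ?_ h1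
    simp [vertexSlack, toReal, ho.symm]
    linarith

/-- The facet normals of the blow-up at `I` through the vertex with slacks `cutSlack I a b`,
where the index `b` stands for the exceptional facet. -/
def cutNormal {n : ℕ} (I : Finset (Fin (n + 1))) (b o : Fin (n + 1)) : Fin n → ℤ :=
  if o = b then blowupNormal I else simplexNormal o

/-- The change of slacks along the edges of the blow-up at `I` through the vertex with slacks
`cutSlack I a b`. -/
def cutDir {n : ℕ} (I : Finset (Fin (n + 1))) (a b o : Fin (n + 1)) : Fin (n + 1) → ℤ :=
  if o = b then Pi.single a 1 - Pi.single b 1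
  else if o ∈ I then Pi.single o 1 - Pi.single a 1
  else Pi.single o 1 - Pi.single b 1

lemma sum_cutDir {n : ℕ} (I : Finset (Fin (n + 1))) (a b o : Fin (n + 1)) :
    ∑ p, cutDir I a b o p = 0 := by
  unfold cutDir
  split_ifs <;> simp

lemma sum_mem_cutDir {n : ℕ} {I : Finset (Fin (n + 1))} {a b : Fin (n + 1)} (ha : a ∈ I)
    (hb : b ∉ I) (o : Fin (n + 1)) : ∑ p ∈ I, cutDir I a b o p = if o = b then 1 else 0 := by
  unfold cutDir
  split_ifs with h1 h2 <;> simp [sum_pi_single', *]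

lemma vertexChart_blowupSet_cut {n : ℕ} {I : Finset (Fin (n + 1))} (hI2 : 2 ≤ I.card)
    (hIn : I.card ≤ n) {a b : Fin (n + 1)} (ha : a ∈ I) (hb : b ∉ I) :
    VertexChart (blowupSet (monotoneSimplex n) (blowupNormal I)) (ofSlack (cutSlack I a b))
      (fun s => cutNormal I b (a.succAbove s))
      (fun s => ofSlackDir (cutDir I a b (a.succAbove s))) := by
  have hIn' : (I.card : ℝ) ≤ n := by exact_mod_cast hIn
  have hI2' : (2 : ℝ) ≤ I.card := by exact_mod_cast hI2
  have hsumI : ∑ o ∈ I, cutSlack I a b o = I.card - 1 := by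
    simp [cutSlack, sum_add_distrib, sum_pi_single', ha, hb]
  refine ⟨?_, ?_, ?_, ?_, ?_⟩
  · refine ofSlack_mem_blowupSet (sum_cutSlack I a b) (fun o => ?_) hsumI.ge
    simp only [cutSlack, Pi.add_apply, Pi.single_apply]
    split_ifs <;> linarith
  · intro s x hx
    rw [cutNormal]
    split_ifs
    · exact hx.2
    · have := mem_monotoneSimplex.1 hx.1 (a.succAbove s)
      rw [slack] at this
      linarith
  · intro s
    rw [cutNormal]
    split_ifs with h
    · rw [dotZ_blowupNormal, slack_ofSlack (sum_cutSlack I a b), hsumI]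
      ring
    · rw [dotZ_simplexNormal_ofSlack (sum_cutSlack I a b)]
      simp [cutSlack, h, Fin.succAbove_ne]
  · intro s t
    simp only [← (Fin.succAbove_right_injective (p := a)).eq_iff (a := s)]
    have hs := Fin.succAbove_ne a s
    have ht := Fin.succAbove_ne a t
    generalize a.succAbove s = o at *
    generalize a.succAbove t = p at *
    rw [cutNormal]
    split_ifs with h1 h2 h2
    · rw [blowupNormal_dotProduct (sum_cutDir I a b p), sum_mem_cutDir ha hb, if_pos (h2 ▸ h1)]
    · rw [blowupNormal_dotProduct (sum_cutDir I a b p), sum_mem_cutDir ha hb,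
        if_neg (fun h => h2 (h1.trans h.symm))]
      simp
    · rw [simplexNormal_dotProduct (sum_cutDir I a b p), cutDir, ← h2, if_neg h1]
      split_ifs <;> simp [hs, h1]
    · rw [simplexNormal_dotProduct (sum_cutDir I a b p), cutDir]
      split_ifs <;> simp [hs, h1, h2]
  · intro t
    have ht := Fin.succAbove_ne a t
    generalize a.succAbove t = p at *
    rw [ofSlack_add_dir]
    refine ofSlack_mem_blowupSet ?_ (fun o => ?_) ?_
    · have h1 : ∑ o, toReal (cutDir I a b p) o = 0 := by
        simp only [toReal]
        rw [← Int.cast_sum, sum_cutDir, Int.cast_zero]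
      simp only [Pi.add_apply, sum_add_distrib, sum_cutSlack, h1, add_zero]
    · simp only [cutSlack, toReal, cutDir, Pi.add_apply, Pi.single_apply]
      split_ifs <;> simp only [Pi.sub_apply, Pi.single_apply] <;> split_ifs <;>
        push_cast <;> linarith
    · have h1 : 0 ≤ ∑ o ∈ I, toReal (cutDir I a b p) o := by
        simp only [toReal]
        rw [← Int.cast_sum, sum_mem_cutDir ha hb]
        split_ifs <;> simp
      simp only [Pi.add_apply, sum_add_distrib, hsumI]
      linarith

lemma monotoneSimplex_eq_convexHull (n : ℕ) :
    monotoneSimplex n =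
      convexHull ℝ (Set.range fun a : Fin (n + 1) => (ofSlack (vertexSlack a) : Fin n → ℝ)) := by
  apply Set.Subset.antisymm
  · intro x hx
    rw [mem_monotoneSimplex] at hx
    have hn : (0 : ℝ) < n + 1 := by positivity
    have h1 : slack x = ∑ a, (slack x a / (n + 1)) • vertexSlack a := by
      ext o
      simp [vertexSlack, Pi.single_apply, hn.ne']
    rw [← ofSlack_slack x, h1]
    refine ofSlack_sum_mem (convex_convexHull ℝ _) (fun a _ => div_nonneg (hx a) hn.le) ?_
      fun a _ => subset_convexHull ℝ _ ⟨a, rfl⟩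
    rw [← sum_div, sum_slack, div_self hn.ne']
  · refine convexHull_min ?_ (convex_monotoneSimplex n)
    rintro _ ⟨a, rfl⟩
    exact (vertexChart_monotoneSimplex a).mem

open Classical in
/-- The vertices of the blow-up of the monotone simplex at the face with index set `I`. -/
noncomputable def blowupVertices {n : ℕ} (I : Finset (Fin (n + 1))) : Finset (Fin n → ℝ) :=
  I.image (fun a => ofSlack (vertexSlack a)) ∪
    (I ×ˢ Iᶜ).image fun p => ofSlack (cutSlack I p.1 p.2)

lemma mem_blowupVertices {n : ℕ} {I : Finset (Fin (n + 1))} {v : Fin n → ℝ} :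
    v ∈ blowupVertices I ↔ (∃ a ∈ I, v = ofSlack (vertexSlack a)) ∨
      ∃ a ∈ I, ∃ b ∉ I, v = ofSlack (cutSlack I a b) := by
  simp [blowupVertices, eq_comm, and_assoc]

lemma exists_vertexChart_blowupSet {n : ℕ} {I : Finset (Fin (n + 1))} (hI2 : 2 ≤ I.card)
    (hIn : I.card ≤ n) {v : Fin n → ℝ} (hv : v ∈ blowupVertices I) :
    ∃ U d, VertexChart (blowupSet (monotoneSimplex n) (blowupNormal I)) v U d := by
  rcases mem_blowupVertices.1 hv with ⟨a, ha, rfl⟩ | ⟨a, ha, b, hb, rfl⟩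
  · exact ⟨_, _, vertexChart_blowupSet_of_mem hIn ha⟩
  · exact ⟨_, _, vertexChart_blowupSet_cut hI2 hIn ha hb⟩

lemma isLatticePt_of_mem_blowupVertices {n : ℕ} {I : Finset (Fin (n + 1))} {v : Fin n → ℝ}
    (hv : v ∈ blowupVertices I) : IsLatticePt v := by
  rcases mem_blowupVertices.1 hv with ⟨a, -, rfl⟩ | ⟨a, -, b, -, rfl⟩
  · convert isLatticePt_ofSlack (n := n) (Pi.single a ((n : ℤ) + 1)) using 2
    ext o
    simp only [vertexSlack, Pi.single_apply]
    split_ifs <;> simp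
  · convert isLatticePt_ofSlack
      (Pi.single a ((I.card : ℤ) - 1) + Pi.single b ((n : ℤ) + 2 - I.card)) using 2
    ext o
    simp only [cutSlack, Pi.add_apply, Pi.single_apply]
    split_ifs <;> simp

lemma blowupSet_eq_convexHull {n : ℕ} {I : Finset (Fin (n + 1))} (hI2 : 2 ≤ I.card)
    (hIn : I.card ≤ n) :
    blowupSet (monotoneSimplex n) (blowupNormal I) =
      convexHull ℝ (blowupVertices I : Set (Fin n → ℝ)) := by
  have hIn' : (I.card : ℝ) ≤ n := by exact_mod_cast hIn
  have hI2' : (2 : ℝ) ≤ I.card := by exact_mod_cast hI2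
  apply Set.Subset.antisymm
  · intro x hx
    obtain ⟨h0, hA⟩ := mem_blowupSet.1 hx
    set C := convexHull ℝ (blowupVertices I : Set (Fin n → ℝ)) with hCdef
    have hC : Convex ℝ C := convex_convexHull ℝ _
    set A := ∑ o ∈ I, slack x o with hAdef
    set c : ℝ := (n : ℝ) + 2 - I.card with hc
    have hA0 : 0 < A := by linarith
    have hc0 : 0 < c := by linarith
    have hAB : A + ∑ o ∈ Iᶜ, slack x o = n + 1 := by rw [hAdef, sum_add_sum_compl, sum_slack]
    set B := ∑ o ∈ Iᶜ, slack x o with hB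
    let z : Fin (n + 1) → Fin (n + 1) → ℝ := fun a =>
      Pi.single a A + fun o => if o ∈ I then 0 else slack x o
    have hz : ∀ a ∈ I, ofSlack (z a) ∈ C := by
      intro a ha
      have hac : a ∉ Iᶜ := by simpa using ha
      have hne : ∀ b ∈ Iᶜ, b ≠ a := fun b hb h => hac (h ▸ hb)
      let w : Fin (n + 1) → ℝ := fun b => if b = a then 1 - B / c else slack x b / c
      let y : Fin (n + 1) → Fin (n + 1) → ℝ := fun b =>
        if b = a then vertexSlack a else cutSlack I a b
      have hwsum : ∑ b ∈ insert a Iᶜ, w b = 1 := by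
        have : ∑ b ∈ Iᶜ, w b = ∑ b ∈ Iᶜ, slack x b / c :=
          sum_congr rfl fun b hb => if_neg (hne b hb)
        rw [sum_insert hac, this, ← sum_div, ← hB]
        simp [w]
      have hzy : z a = ∑ b ∈ insert a Iᶜ, w b • y b := by
        have h1 : ∑ b ∈ Iᶜ, w b • y b = ∑ b ∈ Iᶜ, (slack x b / c) • cutSlack I a b :=
          sum_congr rfl fun b hb => by simp only [w, y, if_neg (hne b hb)]
        rw [sum_insert hac, h1]
        ext o
        have h2 : ∑ b ∈ Iᶜ, slack x b / c * (Pi.single a ((I.card : ℝ) - 1) : Fin (n + 1) → ℝ) o =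
            B / c * (Pi.single a ((I.card : ℝ) - 1) : Fin (n + 1) → ℝ) o := by
          rw [← sum_mul, ← sum_div]
        have h3 : ∑ b ∈ Iᶜ, slack x b / c * (Pi.single b c : Fin (n + 1) → ℝ) o =
            if o ∈ I then 0 else slack x o := by
          simp only [Pi.single_apply, mul_ite, mul_zero, div_mul_cancel₀ _ hc0.ne']
          rw [sum_ite_eq]
          by_cases ho : o ∈ I <;> simp [ho]
        simp only [z, Pi.add_apply, Finset.sum_apply, Pi.smul_apply, smul_eq_mul, cutSlack,
          mul_add, sum_add_distrib, ← hc, h2, h3, w, y, if_true, vertexSlack]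
        rw [← add_assoc]
        congr 1
        by_cases ho : o = a
        · subst ho
          simp only [Pi.single_eq_same]
          field_simp
          rw [show A = n + 1 - B by linarith, hc]
          ring
        · simp [ho]
      rw [hzy]
      refine ofSlack_sum_mem hC ?_ hwsum ?_
      · intro b _
        simp only [w]
        split_ifs
        · rw [sub_nonneg, div_le_one hc0]
          linarith
        · exact div_nonneg (h0 b) hc0.le
      · intro b hb
        apply subset_convexHull ℝ _
        rw [mem_coe, mem_blowupVertices]
        rcases mem_insert.1 hb with rfl | hb
        · exact Or.inl ⟨b, ha, by simp [y]⟩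
        · exact Or.inr ⟨a, ha, b, by simpa using hb, by simp [y, hne b hb]⟩
    have h1 : slack x = ∑ a ∈ I, (slack x a / A) • z a := by
      ext o
      have h2 : ∑ a ∈ I, slack x a / A * (Pi.single a A : Fin (n + 1) → ℝ) o =
          if o ∈ I then slack x o else 0 := by
        simp only [Pi.single_apply, mul_ite, mul_zero, div_mul_cancel₀ _ hA0.ne']
        rw [sum_ite_eq]
      simp only [z, Finset.sum_apply, Pi.smul_apply, Pi.add_apply, smul_eq_mul, mul_add,
        sum_add_distrib, h2]
      rw [← sum_mul, ← sum_div, ← hAdef, div_self hA0.ne']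
      split_ifs <;> simp
    rw [← ofSlack_slack x, h1]
    refine ofSlack_sum_mem hC (fun a _ => div_nonneg (h0 a) hA0.le) ?_ hz
    rw [← sum_div, ← hAdef, div_self hA0.ne']
  · refine convexHull_min ?_ (convex_blowupSet I)
    intro v hv
    obtain ⟨U, d, h⟩ := exists_vertexChart_blowupSet hI2 hIn hv
    exact h.mem

lemma isMonotonePolytope_blowupSet {n : ℕ} {I : Finset (Fin (n + 1))} (hI2 : 2 ≤ I.card)
    (hIn : I.card ≤ n) : IsMonotonePolytope (blowupSet (monotoneSimplex n) (blowupNormal I)) :=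
  isMonotonePolytope_of_charts (blowupVertices I)
    (fun _ => isLatticePt_of_mem_blowupVertices) (blowupSet_eq_convexHull hI2 hIn)
    (zero_mem_interior_blowupSet _) fun _ => exists_vertexChart_blowupSet hI2 hIn

/-- The face of the monotone simplex that is the intersection of the facets with index in `I`. -/
def simplexFace {n : ℕ} (I : Finset (Fin (n + 1))) : Set (Fin n → ℝ) :=
  {x ∈ monotoneSimplex n | ∀ o ∈ I, dotZ (simplexNormal o) x = 1}

lemma simplexFace_eq_tightFace {n : ℕ} {I : Finset (Fin (n + 1))} {a : Fin (n + 1)}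
    (ha : a ∉ I) : simplexFace I = tightFace (monotoneSimplex n)
      (fun s => simplexNormal (a.succAbove s)) (univ.filter fun s => a.succAbove s ∈ I) := by
  ext x
  refine and_congr_right fun _ => ⟨fun h s hs => h _ (mem_filter.1 hs).2, fun h o ho => ?_⟩
  obtain ⟨s, rfl⟩ := Fin.exists_succAbove_eq (ne_of_mem_of_not_mem ho ha)
  exact h s (by simpa using ho)

lemma card_filter_succAbove_mem {n : ℕ} {I : Finset (Fin (n + 1))} {a : Fin (n + 1)}
    (ha : a ∉ I) : (univ.filter fun s => a.succAbove s ∈ I).card = I.card := by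
  refine card_bij (fun s _ => a.succAbove s) (fun s hs => (mem_filter.1 hs).2)
    (fun s _ t _ h => Fin.succAbove_right_injective h) fun o ho => ?_
  obtain ⟨s, rfl⟩ := Fin.exists_succAbove_eq (ne_of_mem_of_not_mem ho ha)
  exact ⟨s, by simpa using ho, rfl⟩

lemma simplexFace_singleton {n : ℕ} (a : Fin (n + 1)) (s : Fin n) :
    simplexFace {a.succAbove s} = tightFace (monotoneSimplex n)
      (fun s => simplexNormal (a.succAbove s)) {s} := by
  simp [simplexFace, tightFace]

lemma exists_notMem_of_card_le {n : ℕ} {I : Finset (Fin (n + 1))} (hIn : I.card ≤ n) :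
    ∃ a, a ∉ I := by
  by_contra! h
  have := card_univ (α := Fin (n + 1))
  rw [← eq_univ_iff_forall.2 h, Fintype.card_fin] at this
  omega

lemma hasCodim_simplexFace {n : ℕ} {I : Finset (Fin (n + 1))} (hIn : I.card ≤ n) :
    HasCodim (monotoneSimplex n) (simplexFace I) I.card := by
  obtain ⟨a, ha⟩ := exists_notMem_of_card_le hIn
  have h := vertexChart_monotoneSimplex a
  rw [simplexFace_eq_tightFace ha]
  refine ⟨h.isFaceOf_tightFace _, ⟨_, h.mem_tightFace _⟩, ?_⟩
  have := h.dimSet_tightFace (univ.filter fun s => a.succAbove s ∈ I)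
  rwa [card_filter_succAbove_mem ha] at this

lemma isCentralNormal_simplexFace {n : ℕ} {I : Finset (Fin (n + 1))} (hIn : I.card ≤ n) :
    IsCentralNormal (monotoneSimplex n) (simplexFace I) (blowupNormal I) := by
  obtain ⟨a, ha⟩ := exists_notMem_of_card_le hIn
  have h := vertexChart_monotoneSimplex a
  have hex : ∀ o ∈ I, ∃ s, a.succAbove s = o := fun o ho =>
    Fin.exists_succAbove_eq (ne_of_mem_of_not_mem ho ha)
  refine ⟨I.card, fun i => simplexFace {(I.equivFin.symm i : Fin (n + 1))},
    fun i => simplexNormal (I.equivFin.symm i : Fin (n + 1)), ?_, ?_, ?_, ?_⟩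
  · intro i j hij
    obtain ⟨s, hs⟩ := hex _ (I.equivFin.symm i).2
    obtain ⟨t, ht⟩ := hex _ (I.equivFin.symm j).2
    simp only [← hs, ← ht, simplexFace_singleton] at hij
    have hst := singleton_injective (h.tightFace_injective hij)
    apply I.equivFin.symm.injective
    apply Subtype.ext
    rw [← hs, ← ht, hst]
  · intro i
    refine ⟨fun x hx => ⟨hx.1, fun o ho => ?_⟩, ?_⟩
    · rw [mem_singleton.1 ho]
      exact hx.2 _ (I.equivFin.symm i).2
    · obtain ⟨s, hs⟩ := hex _ (I.equivFin.symm i).2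
      simp only [← hs, simplexFace_singleton]
      exact h.isFacetNormal_tightFace s
  · intro F hF hsub
    rw [simplexFace_eq_tightFace ha] at hsub
    obtain ⟨s, rfl⟩ := h.exists_eq_of_isFacetOf hF (hsub (h.mem_tightFace _))
    have hs : a.succAbove s ∈ I :=
      (mem_filter.1 (h.subset_of_tightFace_subset hsub (mem_singleton_self s))).2
    exact ⟨I.equivFin ⟨_, hs⟩, by simp [simplexFace_singleton]⟩
  · rw [Equiv.sum_comp I.equivFin.symm fun o => simplexNormal (o : Fin (n + 1)),
      sum_coe_sort I simplexNormal, blowupNormal]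

/-- The monotone simplex admits a monotone blow-up at every face of codimension from `2` to `n`. -/
lemma admitsMonotoneBlowup_simplexFace {n : ℕ} {I : Finset (Fin (n + 1))} (hI2 : 2 ≤ I.card)
    (hIn : I.card ≤ n) :
    AdmitsMonotoneBlowup (monotoneSimplex n) (simplexFace I) (blowupNormal I) := by
  refine ⟨isCentralNormal_simplexFace hIn, fun v hv hvF => ?_,
    isMonotonePolytope_blowupSet hI2 hIn⟩
  rw [monotoneSimplex_eq_convexHull] at hv
  obtain ⟨a, rfl⟩ := mem_of_isVertexOf_convexHull hv
  have ha : a ∈ I := by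
    by_contra ha
    exact hvF (simplexFace_eq_tightFace ha ▸ (vertexChart_monotoneSimplex a).mem_tightFace _)
  have hIn' : (I.card : ℝ) ≤ n := by exact_mod_cast hIn
  rw [dotZ_blowupNormal, slack_ofSlack (sum_vertexSlack a)]
  simp only [vertexSlack, sum_pi_single', if_pos ha]
  linarith

lemma disjoint_removedRegion {n : ℕ} {I J : Finset (Fin (n + 1))} (hIJ : ∀ o, o ∈ I ∨ o ∈ J)
    (hcard : I.card + J.card ≤ n + 3) :
    Disjoint (removedRegion (monotoneSimplex n) (blowupNormal I))
      (removedRegion (monotoneSimplex n) (blowupNormal J)) := by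
  rw [Set.disjoint_left]
  rintro x ⟨hx, hI⟩ ⟨-, hJ⟩
  rw [mem_monotoneSimplex] at hx
  rw [dotZ_blowupNormal] at hI hJ
  have h1 : ∑ o ∈ Iᶜ, slack x o ≤ ∑ o ∈ J, slack x o :=
    sum_le_sum_of_subset_of_nonneg
      (fun o ho => (hIJ o).resolve_left (mem_compl.1 ho)) fun o _ _ => hx o
  have h2 := sum_add_sum_compl I (slack x)
  rw [sum_slack] at h2
  have h3 : (I.card : ℝ) + J.card ≤ n + 3 := by exact_mod_cast hcard
  linarith

/-- for every `n ≥ 4` the monotone simplex `Δ ⊆ ℝ^n` admits two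
disjoint monotone blow-ups at faces of codimension strictly greater than 2. -/
theorem simplex_two_disjoint_blowups_codim_gt_two {n : ℕ} (hn : 4 ≤ n) :
    ∃ (F₁ F₂ : Set (Fin n → ℝ)) (k₁ k₂ : ℕ) (u₁ u₂ : Fin n → ℤ),
      2 < k₁ ∧ 2 < k₂ ∧
      HasCodim (monotoneSimplex n) F₁ k₁ ∧
      HasCodim (monotoneSimplex n) F₂ k₂ ∧
      AdmitsMonotoneBlowup (monotoneSimplex n) F₁ u₁ ∧
      AdmitsMonotoneBlowup (monotoneSimplex n) F₂ u₂ ∧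
      Disjoint (removedRegion (monotoneSimplex n) u₁)
        (removedRegion (monotoneSimplex n) u₂) := by
  have hI : (univ.filter fun o : Fin (n + 1) => (o : ℕ) < 3).card = 3 := by
    rw [Fin.card_filter_val_lt]
    omega
  have hJ : ({0}ᶜ : Finset (Fin (n + 1))).card = n := by simp [card_compl]
  refine ⟨_, _, _, _, _, _, ?_, ?_,
    hasCodim_simplexFace (I := univ.filter fun o : Fin (n + 1) => (o : ℕ) < 3) (by omega),
    hasCodim_simplexFace (I := {0}ᶜ) hJ.le,
    admitsMonotoneBlowup_simplexFace (by omega) (by omega),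
    admitsMonotoneBlowup_simplexFace (by omega) (by omega),
    disjoint_removedRegion (fun o => ?_) (by omega)⟩
  · omega
  · omega
  · by_cases ho : o = 0
    · exact Or.inl (by simp [ho])
    · exact Or.inr (by simpa using ho)
end
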